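/- arXiv:1909.07253 — 10 statements merged into one kernel-verified Lean document; each statement's English description precedes it below -/
import Mathlib

section
/- Let A be a Noetherian integral domain and R a Noetherian commutative ring containing A as a subring with R essentially of finite type over A. Let p be a prime ideal of R with p ∩ A = 0 and n ≥ 1. Then p^{(n)} ⊆ p^{{n}_A} ⊆ p^{⟨n⟩_A}, where p^{(n)} = p^n R_p ∩ R is the n-th symbolic power, p^{{n}_A} = {f ∈ R | δ(f) = 0 for all δ ∈ Diff^{n-1}_{R/A}(R, R/p)}, and p^{⟨n⟩_A} = {f ∈ R | δ(f) ∈ p for all δ ∈ Diff^{n-1}_{R/A}(R, R)}. -/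
set_option linter.unusedSectionVars false

open scoped TensorProduct

namespace NoetherianOps

universe u v

section DiffOps

variable (A R M N : Type*) [CommRing A] [CommRing R] [Algebra A R]
  [AddCommGroup M] [Module A M] [Module R M] [IsScalarTower A R M]
  [AddCommGroup N] [Module A N] [Module R N] [IsScalarTower A R N]

/-- Pre-composition of an `A`-linear map `δ : M →ₗ[A] N` with scalar multiplication by `r : R`,
i.e. the map `m ↦ δ (r • m)`. -/
def preSMul (r : R) (δ : M →ₗ[A] N) : M →ₗ[A] N :=
  δ.comp (r • (LinearMap.id : M →ₗ[A] M))

@[simp] lemma preSMul_apply (r : R) (δ : M →ₗ[A] N) (m : M) :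
    preSMul A R M N r δ m = δ (r • m) := rfl

/-- The bracket `[δ, r] : m ↦ δ (r • m) - r • δ m` of an `A`-linear map `δ : M →ₗ[A] N`
with multiplication by `r : R`. -/
def opBracket (r : R) (δ : M →ₗ[A] N) : M →ₗ[A] N :=
  preSMul A R M N r δ - r • δ

@[simp] lemma opBracket_apply (r : R) (δ : M →ₗ[A] N) (m : M) :
    opBracket A R M N r δ m = δ (r • m) - r • δ m := rfl

/-- `DiffLE A R M N n` is the set of `A`-linear differential operators `M → N` of order
at most `n`: an operator has order `≤ 0` iff all brackets `[δ, r]` vanish (i.e. `δ` is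
`R`-linear), and order `≤ n + 1` iff all brackets `[δ, r]` have order `≤ n`.  This matches
the inductive definition `Diff⁻¹ = 0`, `Diffⁿ = {δ ∣ [δ, r] ∈ Diffⁿ⁻¹ for all r ∈ R}`. -/
def DiffLE : ℕ → Set (M →ₗ[A] N)
  | 0 => {δ | ∀ r : R, opBracket A R M N r δ = 0}
  | n + 1 => {δ | ∀ r : R, opBracket A R M N r δ ∈ DiffLE n}

/-- `Diff A R M N` is the set of all `A`-linear differential operators from `M` to `N`,
i.e. the union of the `DiffLE A R M N n` over all `n`. -/
def Diff : Set (M →ₗ[A] N) := {δ | ∃ n : ℕ, δ ∈ DiffLE A R M N n}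

/-- A subset `E ⊆ Hom_A(M, N)` is an `(R ⊗[A] R)`-submodule iff it is an additive subgroup
closed under the two `R`-actions `δ ↦ r • δ` (post-composition, the action of `r ⊗ 1`) and
`δ ↦ δ ∘ (r • ·)` (pre-composition, the action of `1 ⊗ r`); simple tensors generate
`R ⊗[A] R`, so this is exactly the condition of being an `(R ⊗[A] R)`-submodule for the
module structure `((r ⊗ s) • δ) (m) = r • δ (s • m)`. -/
def IsTensorSubmodule (E : Set (M →ₗ[A] N)) : Prop :=
  (0 : M →ₗ[A] N) ∈ E ∧
  (∀ δ ∈ E, ∀ ε ∈ E, δ + ε ∈ E) ∧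
  (∀ δ ∈ E, -δ ∈ E) ∧
  (∀ (r : R), ∀ δ ∈ E, r • δ ∈ E) ∧
  (∀ (r : R), ∀ δ ∈ E, preSMul A R M N r δ ∈ E)

end DiffOps

/-- The solution set of a family `E` of operators `M → N`: the set of `m ∈ M` killed by
every member of `E`. -/
def Sol {A M N : Type*} [CommRing A] [AddCommGroup M] [Module A M]
    [AddCommGroup N] [Module A N] (E : Set (M →ₗ[A] N)) : Set M :=
  {m | ∀ δ ∈ E, δ m = 0}

/-- `E` is finitely generated via the left (post-composition) `R'`-module structure on
`Hom_A(M, N)`: there is a finite subset of `E` such that every element of `E` is an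
`R'`-linear combination (for the action `(r • δ) m = r • δ m`) of its members. -/
def IsFGLeft {A M N : Type*} (R' : Type*) [CommRing A] [CommRing R']
    [AddCommGroup M] [Module A M] [AddCommGroup N] [Module A N]
    [Module R' N] [SMulCommClass A R' N] (E : Set (M →ₗ[A] N)) : Prop :=
  ∃ s : Finset (M →ₗ[A] N), ↑s ⊆ E ∧
    ∀ δ ∈ E, ∃ c : (M →ₗ[A] N) → R', δ = ∑ g ∈ s, c g • g

/-- A field extension `L/K` is separable (in the general, not necessarily algebraic, sense)
if `L ⊗[K] K'` is reduced for every field extension `K'/K` (MacLane's criterion). -/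
def IsSeparableFieldExtension (K : Type u) (L : Type v) [Field K] [Field L] [Algebra K L] :
    Prop :=
  ∀ (K' : Type u) [Field K'] [Algebra K K'], IsReduced (L ⊗[K] K')

end NoetherianOps
namespace NoetherianOps

lemma diff_pow_eq_zero (A R : Type*) [CommRing A] [CommRing R] [Algebra A R]
    (p : Ideal R) (n : ℕ) : ∀ δ ∈ DiffLE A R R (R ⧸ p) n, ∀ f ∈ p ^ (n + 1), δ f = 0 := by
  have hz : ∀ r ∈ p, ∀ x : R ⧸ p, r • x = 0 := by
    intro r hr x
    rw [Algebra.smul_def, Ideal.Quotient.algebraMap_eq, Ideal.Quotient.eq_zero_iff_mem.mpr hr,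
      zero_mul]
  induction n with
  | zero =>
    intro δ hδ f hf
    have h := LinearMap.congr_fun (hδ f) (1 : R)
    rw [zero_add, pow_one] at hf
    simpa [hz f hf] using h
  | succ n ih =>
    intro δ hδ f hf
    rw [pow_succ' p (n + 1)] at hf
    induction hf using Submodule.mul_induction_on' with
    | mem_mul_mem r hr g hg =>
      have h := ih _ (hδ r) g hg
      rw [opBracket_apply, hz r hr, sub_zero] at h
      simpa using h
    | add x _ y _ hx hy => rw [map_add, hx, hy, add_zero]

lemma diff_symb_eq_zero (A R : Type*) [CommRing A] [CommRing R] [Algebra A R]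
    (p : Ideal R) [p.IsPrime] (s : R) (hs : s ∉ p) (f : R) (n : ℕ) :
    ∀ δ ∈ DiffLE A R R (R ⧸ p) n, s * f ∈ p ^ (n + 1) → δ f = 0 := by
  have hc : ∀ x : R ⧸ p, s • x = 0 → x = 0 := by
    intro x hx
    rw [Algebra.smul_def, Ideal.Quotient.algebraMap_eq] at hx
    exact (mul_eq_zero.mp hx).resolve_left fun h => hs (Ideal.Quotient.eq_zero_iff_mem.mp h)
  induction n with
  | zero =>
    intro δ hδ hf
    have h := LinearMap.congr_fun (hδ s) f
    have h2 := diff_pow_eq_zero A R p 0 δ hδ _ hf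
    rw [opBracket_apply, smul_eq_mul, h2] at h
    exact hc _ (by simpa using h)
  | succ n ih =>
    intro δ hδ hf
    have h := ih _ (hδ s) (Ideal.pow_le_pow_right (by omega) hf)
    have h2 := diff_pow_eq_zero A R p (n + 1) δ hδ _ hf
    rw [opBracket_apply, smul_eq_mul, h2] at h
    exact hc _ (by simpa using h)

lemma diff_comp_mk (A R : Type*) [CommRing A] [CommRing R] [Algebra A R]
    (p : Ideal R) (n : ℕ) : ∀ δ ∈ DiffLE A R R R n,
      (Ideal.Quotient.mkₐ A p).toLinearMap.comp δ ∈ DiffLE A R R (R ⧸ p) n := by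
  have key : ∀ (r : R) (δ : R →ₗ[A] R),
      opBracket A R R (R ⧸ p) r ((Ideal.Quotient.mkₐ A p).toLinearMap.comp δ) =
        (Ideal.Quotient.mkₐ A p).toLinearMap.comp (opBracket A R R R r δ) := by
    intro r δ
    ext x
    simp [Algebra.smul_def]
  induction n with
  | zero =>
    intro δ hδ r
    rw [key, hδ r, LinearMap.comp_zero]
  | succ n ih =>
    intro δ hδ r
    rw [key]
    exact ih _ (hδ r)

/-- **Symbolic powers and the two notions of differential powers** (Theorem 4.6(i)).
Let `A` be a Noetherian integral domain and `R ⊇ A` a Noetherian ring essentially of finite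
type over `A`, and let `p` be a prime of `R` with `p ∩ A = 0`.  For `n ≥ 1` one has
`p^{(n)} ⊆ p^{{n}_A} ⊆ p^{⟨n⟩_A}`, where `p^{(n)} = pⁿR_p ∩ R` is the symbolic power,
`p^{{n}_A} = {f ∣ δ f = 0 for all δ ∈ Diffⁿ⁻¹_{R/A}(R, R/p)}` and
`p^{⟨n⟩_A} = {f ∣ δ f ∈ p for all δ ∈ Diffⁿ⁻¹_{R/A}(R, R)}`. -/
theorem symbolicPower_subset_diffPower_subset_diffPower'
    (A R : Type*) [CommRing A] [CommRing R] [IsDomain A]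
    [IsNoetherianRing A] [IsNoetherianRing R] [Algebra A R]
    (hAR : Function.Injective (algebraMap A R))
    [Algebra.EssFiniteType A R]
    (p : Ideal R) [p.IsPrime]
    (hpA : ∀ a : A, algebraMap A R a ∈ p → a = 0)
    (n : ℕ) (hn : 1 ≤ n) :
    ((Ideal.comap (algebraMap R (Localization.AtPrime p))
        (Ideal.map (algebraMap R (Localization.AtPrime p)) (p ^ n)) : Ideal R) : Set R)
      ⊆ {f : R | ∀ δ ∈ DiffLE A R R (R ⧸ p) (n - 1), δ f = 0} ∧
    {f : R | ∀ δ ∈ DiffLE A R R (R ⧸ p) (n - 1), δ f = 0}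
      ⊆ {f : R | ∀ δ ∈ DiffLE A R R R (n - 1), δ f ∈ p} := by
  obtain ⟨n, rfl⟩ : ∃ m, n = m + 1 := ⟨n - 1, by omega⟩
  simp only [Nat.add_sub_cancel]
  constructor
  · intro f hf δ hδ
    rw [SetLike.mem_coe, Ideal.mem_comap] at hf
    rw [IsLocalization.algebraMap_mem_map_algebraMap_iff p.primeCompl] at hf
    obtain ⟨s, hs, h⟩ := hf
    exact diff_symb_eq_zero A R p s hs f n δ hδ h
  · intro f hf δ hδ
    have h := hf _ (diff_comp_mk A R p n δ hδ)
    exact Ideal.Quotient.eq_zero_iff_mem.mp h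

end NoetherianOps
end

section
/- Let A be a Noetherian integral domain with field of fractions Quot(A) and R a Noetherian commutative ring containing A as a subring with R essentially of finite type over A. Let p be a prime ideal of R with p ∩ A = 0 such that Quot(A) ↪ k(p) = R_p/pR_p is a separable field extension (which holds whenever Quot(A) is perfect). Then for all n ≥ 1, p^{(n)} = p^{{n}_A}, where p^{(n)} = p^n R_p ∩ R and p^{{n}_A} = {f ∈ R | δ(f) = 0 for all δ ∈ Diff^{n-1}_{R/A}(R, R/p)}. -/
set_option linter.unusedSectionVars false

open scoped TensorProduct

namespace NoetherianOps

open scoped TensorProduct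

lemma linearIndepOn_pow_of_sep {k : Type u} {L : Type v} [Field k] [Field L] [Algebra k L]
    (hsep : IsSeparableFieldExtension k L) (p : ℕ) (hp : p.Prime) [CharP k p]
    (s : Finset L) (hs : LinearIndepOn k _root_.id (s : Set L)) :
    LinearIndepOn k (· ^ p) (s : Set L) := by
  have : Fact p.Prime := ⟨hp⟩
  have hred := hsep (AlgebraicClosure k)
  have : ExpChar k p := .prime hp
  have : ExpChar (L ⊗[k] AlgebraicClosure k) p :=
    expChar_of_injective_algebraMap (algebraMap k (L ⊗[k] AlgebraicClosure k)).injective p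
  rw [linearIndepOn_finset_iff]
  intro c hc x hx
  have hroot : ∀ i : L, ∃ d : AlgebraicClosure k, d ^ p = algebraMap k _ (c i) := fun i =>
    IsAlgClosed.exists_pow_nat_eq _ hp.pos
  choose d hd using hroot
  have hz : ∑ i ∈ s, i ⊗ₜ[k] d i = 0 := by
    apply eq_zero_of_pow_eq_zero (n := p)
    rw [sum_pow_char p]
    have : ∀ i ∈ s, (i ⊗ₜ[k] d i) ^ p = (c i • i ^ p) ⊗ₜ[k] (1 : AlgebraicClosure k) := by
      intro i _
      rw [Algebra.TensorProduct.tmul_pow, hd, Algebra.algebraMap_eq_smul_one,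
        TensorProduct.tmul_smul, TensorProduct.smul_tmul']
    rw [Finset.sum_congr rfl this, ← TensorProduct.sum_tmul, hc, TensorProduct.zero_tmul]
  classical
  let b := Module.Basis.extend hs
  have hmem : ∀ i ∈ s, i ∈ hs.extend (Set.subset_univ _) := fun i hi =>
    hs.subset_extend _ hi
  let f : L →ₗ[k] k := b.coord ⟨x, hmem x hx⟩
  have hf : ∀ i ∈ s, f i = if i = x then 1 else 0 := by
    intro i hi
    have : b ⟨i, hmem i hi⟩ = i := Module.Basis.extend_apply_self hs _
    conv_lhs => rw [← this]
    simp [f, Finsupp.single_apply]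
  have h := congrArg ((TensorProduct.lid k (AlgebraicClosure k)).toLinearMap ∘ₗ
    LinearMap.rTensor (AlgebraicClosure k) f) hz
  simp only [map_sum, LinearMap.comp_apply, LinearMap.rTensor_tmul, LinearEquiv.coe_coe,
    TensorProduct.lid_tmul, map_zero] at h
  rw [Finset.sum_congr rfl (fun i hi => by rw [hf i hi])] at h
  simp [hx] at h
  have := hd x
  rw [h, zero_pow hp.ne_zero] at this
  simpa using this.symm

lemma formallySmooth_of_sep {k : Type u} {L : Type v} [Field k] [Field L] [Algebra k L]
    (hsep : IsSeparableFieldExtension k L) [Algebra.EssFiniteType k L] :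
    Algebra.FormallySmooth k L := by
  obtain _ | ⟨p, hp, hpk⟩ := CharP.exists' k
  · infer_instance
  have : ExpChar k p := .prime hp.out
  obtain ⟨s, hs, H⟩ :=
    exists_isTranscendenceBasis_and_isSeparable_of_linearIndepOn_pow_of_essFiniteType
    p hp.out (linearIndepOn_pow_of_sep hsep p hp.out)
  have : Algebra.IsSeparable (↥(IntermediateField.adjoin k (Set.range ((↑) : s → L)))) L := by
    convert! H <;> simp
  exact .of_algebraicIndependent_of_isSeparable hs.1

section DiffLemmas

variable {A R N N' : Type*} [CommRing A] [CommRing R] [Algebra A R]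
  [AddCommGroup N] [Module A N] [Module R N] [IsScalarTower A R N]
  [AddCommGroup N'] [Module A N'] [Module R N'] [IsScalarTower A R N']

lemma DiffLE_mono_succ (m : ℕ) (δ : R →ₗ[A] N) (h : δ ∈ DiffLE A R R N m) :
    δ ∈ DiffLE A R R N (m + 1) := by
  induction m generalizing δ with
  | zero =>
    intro r t
    rw [h r]
    ext; simp
  | succ m ih => exact fun r => ih _ (h r)

lemma DiffLE_smul (m : ℕ) (s : R) (δ : R →ₗ[A] N) (h : δ ∈ DiffLE A R R N m) :
    s • δ ∈ DiffLE A R R N m := by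
  have key : ∀ (r : R) (δ : R →ₗ[A] N),
      opBracket A R R N r (s • δ) = s • opBracket A R R N r δ := by
    intro r δ
    ext x
    simp only [opBracket_apply, LinearMap.smul_apply, smul_sub, smul_comm r s]
  induction m generalizing δ with
  | zero => intro r; rw [key, h r, smul_zero]
  | succ m ih => intro r; rw [key]; exact ih _ (h r)

lemma DiffLE_of_injective (m : ℕ) (ι : N →ₗ[R] N') (hι : Function.Injective ι)
    (δ : R →ₗ[A] N) (δ' : R →ₗ[A] N') (hδ : ∀ x, ι (δ x) = δ' x)
    (h : δ' ∈ DiffLE A R R N' m) : δ ∈ DiffLE A R R N m := by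
  have key : ∀ (δ : R →ₗ[A] N) (δ' : R →ₗ[A] N'), (∀ x, ι (δ x) = δ' x) → ∀ r x,
      ι (opBracket A R R N r δ x) = opBracket A R R N' r δ' x := by
    intro δ δ' h r x
    simp only [opBracket_apply, map_sub, map_smul, h]
  induction m generalizing δ δ' with
  | zero =>
    intro r
    ext x
    apply hι
    rw [key δ δ' hδ, h r]; simp
  | succ m ih => exact fun r => ih _ _ (key δ δ' hδ r) (h r)

lemma opBracket_mul (r s : R) (δ : R →ₗ[A] N) (x : R) :
    opBracket A R R N (r * s) δ x =
      opBracket A R R N r δ (s * x) + r • opBracket A R R N s δ x := by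
  simp only [opBracket_apply, smul_eq_mul, smul_sub, mul_smul, mul_assoc]
  abel

/-- A differential operator on an algebra essentially of finite type has image in a finitely
generated submodule. -/
lemma DiffLE_fg [Algebra.EssFiniteType A R] (m : ℕ) (δ : R →ₗ[A] N)
    (h : δ ∈ DiffLE A R R N m) : ∃ P : Submodule R N, P.FG ∧ ∀ x, δ x ∈ P := by
  induction m generalizing δ with
  | zero =>
    refine ⟨Submodule.span R {δ 1}, Submodule.fg_span_singleton _, fun x => ?_⟩
    have := congrArg (fun f => f 1) (h x)
    simp only [opBracket_apply, smul_eq_mul, mul_one, LinearMap.zero_apply, sub_eq_zero] at this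
    rw [this]
    exact Submodule.smul_mem _ _ (Submodule.mem_span_singleton_self _)
  | succ m ih =>
    obtain ⟨σ, hσ⟩ := (Algebra.essFiniteType_iff A R).1 inferInstance
    choose Q hQfg hQ using fun r => ih _ (h r)
    let P : Submodule R N := Submodule.span R {δ 1} ⊔ σ.sup Q
    have hP : P.FG := (Submodule.fg_span_singleton _).sup
      (Submodule.fg_finset_sup _ _ fun r _ => hQfg r)
    let T : Subalgebra A R :=
      { carrier := {r | ∀ x, opBracket A R R N r δ x ∈ P}
        mul_mem' := fun {a b} ha hb x => by
          rw [opBracket_mul]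
          exact P.add_mem (ha _) (P.smul_mem _ (hb _))
        add_mem' := fun {a b} ha hb x => by
          have : opBracket A R R N (a + b) δ x =
            opBracket A R R N a δ x + opBracket A R R N b δ x := by
            simp only [opBracket_apply, add_smul, map_add]; abel
          rw [this]
          exact P.add_mem (ha _) (hb _)
        algebraMap_mem' := fun a x => by
          have : opBracket A R R N (algebraMap A R a) δ x = 0 := by
            rw [opBracket_apply, algebraMap_smul, algebraMap_smul, map_smul, sub_self]
          rw [this]
          exact P.zero_mem }
    have hT : Algebra.adjoin A (σ : Set R) ≤ T := Algebra.adjoin_le fun r hr x =>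
      (le_sup_of_le_right (Finset.le_sup (f := Q) hr) : Q r ≤ P) (hQ r x)
    have hall : ∀ r, r ∈ T := by
      intro r
      obtain ⟨t, ht, ⟨u, rfl⟩, hrt⟩ := hσ r
      have hinv : (↑u⁻¹ : R) ∈ T := by
        intro x
        have h1 := opBracket_mul (u : R) (↑u⁻¹ : R) δ x
        have h0 : opBracket A R R N ((u : R) * ↑u⁻¹) δ x = 0 := by simp
        rw [h0] at h1
        have h2 : (u : R) • opBracket A R R N (↑u⁻¹ : R) δ x ∈ P := by
          rw [← neg_eq_of_add_eq_zero_right h1.symm]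
          exact P.neg_mem (hT ht _)
        have h3 := P.smul_mem (↑u⁻¹ : R) h2
        rwa [smul_smul, Units.inv_mul, one_smul] at h3
      have := T.mul_mem (hT hrt) hinv
      rwa [mul_assoc, Units.mul_inv, mul_one] at this
    refine ⟨P, hP, fun x => ?_⟩
    have h1 : δ x = opBracket A R R N x δ 1 + x • δ 1 := by simp [opBracket_apply]
    rw [h1]
    exact P.add_mem (hall x 1) (P.smul_mem _
      ((le_sup_left : _ ≤ P) (Submodule.mem_span_singleton_self _)))

end DiffLemmas

section Easy

variable {A R : Type*} [CommRing A] [CommRing R] [Algebra A R] (p : Ideal R)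

lemma DiffLE_pow (m : ℕ) (δ : R →ₗ[A] R ⧸ p) (h : δ ∈ DiffLE A R R (R ⧸ p) m) (f : R)
    (hf : f ∈ p ^ (m + 1)) : δ f = 0 := by
  have hp0 : ∀ r ∈ p, ∀ y : R ⧸ p, r • y = 0 := by
    intro r hr y
    rw [Algebra.smul_def, Ideal.Quotient.algebraMap_eq, Ideal.Quotient.eq_zero_iff_mem.2 hr,
      zero_mul]
  induction m generalizing δ f with
  | zero =>
    have := congrArg (fun g => g 1) (h f)
    simp only [opBracket_apply, smul_eq_mul, mul_one, LinearMap.zero_apply, sub_eq_zero] at this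
    rw [this]
    exact hp0 f (by simpa using hf) _
  | succ m ih =>
    rw [pow_succ'] at hf
    induction hf using Submodule.mul_induction_on' with
    | mem_mul_mem r hr x hx =>
      have := ih _ (h r) x hx
      rw [opBracket_apply, hp0 r hr, sub_zero, smul_eq_mul] at this
      exact this
    | add x _ y _ hx hy => rw [map_add, hx, hy, add_zero]

lemma DiffLE_cancel [p.IsPrime] (s : R) (hs : s ∉ p) (f : R) (m : ℕ)
    (hsf : ∀ δ ∈ DiffLE A R R (R ⧸ p) m, δ (s * f) = 0) :
    ∀ δ ∈ DiffLE A R R (R ⧸ p) m, δ f = 0 := by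
  have key : ∀ δ : R →ₗ[A] R ⧸ p, δ (s * f) = 0 → opBracket A R R (R ⧸ p) s δ f = 0 →
      δ f = 0 := by
    intro δ h1 h2
    rw [opBracket_apply, smul_eq_mul, h1, zero_sub, neg_eq_zero, Algebra.smul_def,
      mul_eq_zero, Ideal.Quotient.algebraMap_eq, Ideal.Quotient.eq_zero_iff_mem] at h2
    exact h2.resolve_left hs
  induction m with
  | zero => exact fun δ h => key δ (hsf δ h) (by rw [h s]; rfl)
  | succ m ih =>
    exact fun δ h => key δ (hsf δ h) (ih (fun δ' h' => hsf δ' (DiffLE_mono_succ m δ' h')) _ (h s))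

end Easy

lemma DiffLE_of_section {A R K B : Type*} [CommRing A] [CommRing R] [Algebra A R]
    [Field K] [Algebra R K] [Algebra A K] [IsScalarTower A R K]
    [CommRing B] [Algebra A B] (π : R →ₐ[A] B) (g : B →ₐ[A] K) (σ : K →ₐ[A] B)
    (hσ : ∀ k, g (σ k) = k) (hgπ : ∀ r, g (π r) = algebraMap R K r)
    (φ : B →ₗ[A] K) (hφ : ∀ k b, φ (σ k * b) = k * φ b) (n : ℕ)
    (hn : (RingHom.ker g) ^ n = ⊥) (j i : ℕ) (hij : i + (j + 1) = n)
    (c : B) (hc : c ∈ (RingHom.ker g) ^ i) (δ : R →ₗ[A] K) (hδ : ∀ x, δ x = φ (c * π x)) :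
    δ ∈ DiffLE A R R K j := by
  have key : ∀ (c : B) (δ : R →ₗ[A] K), (∀ x, δ x = φ (c * π x)) → ∀ r x,
      opBracket A R R K r δ x = φ (c * (π r - σ (algebraMap R K r)) * π x) := by
    intro c δ hδ r x
    rw [opBracket_apply, hδ, hδ, smul_eq_mul, Algebra.smul_def, ← hφ, ← map_sub, map_mul]
    congr 1
    ring
  have hmem : ∀ r, π r - σ (algebraMap R K r) ∈ RingHom.ker g := by
    intro r
    rw [RingHom.mem_ker, map_sub, hσ, hgπ, sub_self]
  induction j generalizing i c δ with
  | zero =>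
    intro r
    ext x
    have : c * (π r - σ (algebraMap R K r)) ∈ (RingHom.ker g) ^ n := by
      rw [← hij, zero_add, pow_succ]
      exact Ideal.mul_mem_mul hc (hmem r)
    rw [hn, Ideal.mem_bot] at this
    rw [key c δ hδ, this]; simp
  | succ j ih =>
    intro r
    refine ih (i + 1) (by omega) (c * (π r - σ (algebraMap R K r))) ?_ _ (key c δ hδ r)
    rw [pow_succ]
    exact Ideal.mul_mem_mul hc (hmem r)

/-- Clearing denominators. -/
lemma exists_clear_denominators {A R : Type*} [CommRing A] [CommRing R] [Algebra A R]
    [Algebra.EssFiniteType A R] (p : Ideal R) [p.IsPrime]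
    (K : Type*) [Field K] [Algebra (R ⧸ p) K] [IsFractionRing (R ⧸ p) K]
    [Algebra R K] [IsScalarTower R (R ⧸ p) K] [Algebra A K] [IsScalarTower A R K]
    (m : ℕ) (δ : R →ₗ[A] K) (h : δ ∈ DiffLE A R R K m) (f : R) (hf : δ f ≠ 0) :
    ∃ δ' ∈ DiffLE A R R (R ⧸ p) m, δ' f ≠ 0 := by
  obtain ⟨P, ⟨t, rfl⟩, hP⟩ := DiffLE_fg m δ h
  obtain ⟨b, hb⟩ := IsLocalization.exist_integer_multiples_of_finset
    (nonZeroDivisors (R ⧸ p)) t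
  obtain ⟨s, hs⟩ := Ideal.Quotient.mk_surjective (b : R ⧸ p)
  let ι : (R ⧸ p) →ₗ[R] K := (IsScalarTower.toAlgHom R (R ⧸ p) K).toLinearMap
  have hιa : ∀ x, ι x = algebraMap (R ⧸ p) K x := fun _ => rfl
  have hι : Function.Injective ι := IsFractionRing.injective (R ⧸ p) K
  have hsmul : ∀ y : K, s • y = (b : R ⧸ p) • y := by
    intro y
    rw [← hs, ← Ideal.Quotient.algebraMap_eq, algebraMap_smul]
  have hr : ∀ y ∈ Submodule.span R (t : Set K), s • y ∈ LinearMap.range ι := by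
    intro y hy
    induction hy using Submodule.span_induction with
    | mem x hx =>
      obtain ⟨z, hz⟩ := hb x hx
      exact ⟨z, by rw [hsmul, hιa, hz]⟩
    | zero => rw [smul_zero]; exact zero_mem _
    | add x y _ _ hx hy => rw [smul_add]; exact add_mem hx hy
    | smul a x _ hx => rw [smul_comm]; exact Submodule.smul_mem _ _ hx
  let e := (LinearEquiv.ofInjective ι hι)
  let δ₁ : R →ₗ[A] LinearMap.range ι :=
    LinearMap.codRestrict ((LinearMap.range ι).restrictScalars A) (s • δ)
      (fun x => hr _ (hP x))
  let δ' : R →ₗ[A] R ⧸ p := (e.symm.toLinearMap.restrictScalars A) ∘ₗ δ₁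
  have hδ' : ∀ x, ι (δ' x) = (s • δ) x := by
    intro x
    have : e (δ' x) = δ₁ x := e.apply_symm_apply _
    exact congrArg Subtype.val this
  refine ⟨δ', DiffLE_of_injective m ι hι δ' (s • δ) hδ' (DiffLE_smul m s δ h), ?_⟩
  intro h0
  have := hδ' f
  rw [h0, map_zero, LinearMap.smul_apply, hsmul, Algebra.smul_def] at this
  have hb0 : algebraMap (R ⧸ p) K b ≠ 0 :=
    IsFractionRing.to_map_ne_zero_of_mem_nonZeroDivisors b.2
  exact mul_ne_zero hb0 hf this.symm

end NoetherianOps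
namespace NoetherianOps

lemma exists_operator {A R : Type*} [CommRing A] [CommRing R] [IsDomain A] [Algebra A R]
    [Algebra.EssFiniteType A R]
    (p : Ideal R) [p.IsPrime]
    (hpA : ∀ a : A, algebraMap A R a ∈ p → a = 0)
    (FA : Type*) [Field FA] [Algebra A FA] [IsFractionRing A FA]
    (K : Type*) [Field K] [Algebra (R ⧸ p) K] [IsFractionRing (R ⧸ p) K]
    [Algebra R K] [IsScalarTower R (R ⧸ p) K] [Algebra A K] [IsScalarTower A R K]
    [Algebra FA K] [IsScalarTower A FA K]
    (hsep : IsSeparableFieldExtension FA K) (n : ℕ) (f : R)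
    (hf : algebraMap R (Localization.AtPrime p) f ∉
      Ideal.map (algebraMap R (Localization.AtPrime p)) (p ^ (n + 1))) :
    ∃ δ ∈ DiffLE A R R K n, δ f ≠ 0 := by
  -- formal smoothness of `K` over `A`
  have : Algebra.EssFiniteType (R ⧸ p) K := .of_isLocalization K (nonZeroDivisors (R ⧸ p))
  have : Algebra.EssFiniteType R K := .comp R (R ⧸ p) K
  have : Algebra.EssFiniteType A K := .comp A R K
  have : Algebra.EssFiniteType FA K := .of_comp A FA K
  have : Algebra.FormallySmooth FA K := formallySmooth_of_sep hsep
  have : Algebra.FormallySmooth A FA := .of_isLocalization (nonZeroDivisors A)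
  have : Algebra.FormallySmooth A K := .comp A FA K
  have hker : ∀ r : R, algebraMap R K r = 0 ↔ r ∈ p := by
    intro r
    rw [IsScalarTower.algebraMap_apply R (R ⧸ p) K, ← Ideal.Quotient.eq_zero_iff_mem,
      Ideal.Quotient.algebraMap_eq]
    exact map_eq_zero_iff _ (IsFractionRing.injective (R ⧸ p) K)
  let S := Localization.AtPrime p
  have hunit : ∀ y : p.primeCompl, IsUnit ((IsScalarTower.toAlgHom A R K) (y : R)) := by
    intro y
    rw [isUnit_iff_ne_zero]
    exact fun h => y.2 ((hker _).1 h)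
  let g₀ : S →ₐ[A] K := IsLocalization.liftAlgHom (M := p.primeCompl) hunit
  have hg₀ : ∀ r, g₀ (algebraMap R S r) = algebraMap R K r := fun r =>
    IsLocalization.lift_eq (M := p.primeCompl) hunit r
  have hkerg₀ : RingHom.ker g₀ = Ideal.map (algebraMap R S) p := by
    apply le_antisymm
    · intro x hx
      obtain ⟨⟨r, s⟩, hrs⟩ := IsLocalization.surj p.primeCompl x
      have hr : r ∈ p := by
        rw [← hker, ← hg₀]
        simp only at hrs
        rw [← hrs, map_mul, (RingHom.mem_ker).1 hx, zero_mul]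
      have h1 : x * algebraMap R S s ∈ Ideal.map (algebraMap R S) p := by
        rw [hrs]; exact Ideal.mem_map_of_mem _ hr
      exact (Ideal.mul_unit_mem_iff_mem _ (IsLocalization.map_units S s)).1 h1
    · rw [Ideal.map_le_iff_le_comap]
      intro r hr
      rw [Ideal.mem_comap, RingHom.mem_ker, hg₀, hker]
      exact hr
  let I : Ideal S := Ideal.map (algebraMap R S) (p ^ (n + 1))
  have hI : I = (RingHom.ker g₀) ^ (n + 1) := by rw [hkerg₀, ← Ideal.map_pow]
  have hIg : ∀ x ∈ I, g₀ x = 0 := by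
    intro x hx
    rw [hI] at hx
    exact Ideal.pow_le_self (Nat.succ_ne_zero n) hx
  let g : S ⧸ I →ₐ[A] K := Ideal.Quotient.liftₐ I g₀ hIg
  have hg : ∀ x, g (Ideal.Quotient.mk I x) = g₀ x := fun x => rfl
  have hgsurj : Function.Surjective g := by
    intro k
    obtain ⟨a, b, hb, rfl⟩ := IsFractionRing.div_surjective (A := R ⧸ p) k
    obtain ⟨a, rfl⟩ := Ideal.Quotient.mk_surjective a
    obtain ⟨b, rfl⟩ := Ideal.Quotient.mk_surjective b
    have hbp : b ∉ p := fun h => nonZeroDivisors.ne_zero hb (Ideal.Quotient.eq_zero_iff_mem.2 h)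
    refine ⟨Ideal.Quotient.mk I (IsLocalization.mk' S a (⟨b, hbp⟩ : p.primeCompl)), ?_⟩
    rw [hg]
    have hb0 : algebraMap R K b ≠ 0 := fun h => hbp ((hker b).1 h)
    rw [← Ideal.Quotient.algebraMap_eq, ← IsScalarTower.algebraMap_apply,
      ← IsScalarTower.algebraMap_apply, eq_div_iff hb0, ← hg₀, ← hg₀, ← map_mul]
    exact congrArg g₀ (IsLocalization.mk'_spec S a (⟨b, hbp⟩ : p.primeCompl))
  have hkerg : (RingHom.ker g) ^ (n + 1) = ⊥ := by
    have h1 : RingHom.ker g ≤ Ideal.map (Ideal.Quotient.mk I) (RingHom.ker g₀) := by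
      intro x hx
      obtain ⟨x, rfl⟩ := Ideal.Quotient.mk_surjective x
      exact Ideal.mem_map_of_mem _ hx
    rw [eq_bot_iff]
    refine (Ideal.pow_right_mono h1 _).trans ?_
    rw [← Ideal.map_pow, ← hI, Ideal.map_quotient_self]
  let σ : K →ₐ[A] S ⧸ I := Algebra.FormallySmooth.liftOfSurjective (AlgHom.id A K) g hgsurj
    ⟨n + 1, hkerg⟩
  have hσ : ∀ k, g (σ k) = k := fun k =>
    Algebra.FormallySmooth.liftOfSurjective_apply (AlgHom.id A K) g hgsurj ⟨n + 1, hkerg⟩ k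
  let π : R →ₐ[A] S ⧸ I := (Ideal.Quotient.mkₐ A I).comp (IsScalarTower.toAlgHom A R S)
  have hπ : ∀ r, π r = Ideal.Quotient.mk I (algebraMap R S r) := fun r => rfl
  have hπf : π f ≠ 0 := by
    rw [hπ, Ne, Ideal.Quotient.eq_zero_iff_mem]
    exact hf
  obtain ⟨φ, hφ, hφf⟩ : ∃ φ : (S ⧸ I) →ₗ[A] K, (∀ k b, φ (σ k * b) = k * φ b) ∧ φ (π f) ≠ 0 := by
    let _ : Algebra K (S ⧸ I) := σ.toRingHom.toAlgebra
    have hsm : ∀ (k : K) (b : S ⧸ I), k • b = σ k * b := fun k b => rfl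
    have : IsScalarTower A K (S ⧸ I) := IsScalarTower.of_algebraMap_eq fun a =>
      (σ.commutes a).symm
    by_contra hcon
    push Not at hcon
    apply hπf
    rw [← Module.forall_dual_apply_eq_zero_iff K]
    intro φ
    refine hcon (φ.restrictScalars A) fun k b => ?_
    rw [← hsm]
    simp
  refine ⟨φ ∘ₗ π.toLinearMap, ?_, hφf⟩
  exact DiffLE_of_section π g σ hσ (fun r => by rw [hπ, hg, hg₀]) φ hφ (n + 1) hkerg n 0
    (by omega) 1 (by simp) _ (fun x => by simp)

end NoetherianOps
namespace NoetherianOps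

/-- **Zariski–Nagata for the new differential powers** (Theorem 4.6(ii)).  If moreover
`Quot(A) ↪ k(p)` is a separable field extension (`k(p)` realized as the fraction field `K`
of `R/p`), then for all `n ≥ 1` the symbolic power `p^{(n)} = pⁿR_p ∩ R` equals the
differential power `p^{{n}_A} = {f ∣ δ f = 0 for all δ ∈ Diffⁿ⁻¹_{R/A}(R, R/p)}`. -/
theorem symbolicPower_eq_diffPower
    (A R : Type*) [CommRing A] [CommRing R] [IsDomain A]
    [IsNoetherianRing A] [IsNoetherianRing R] [Algebra A R]
    (hAR : Function.Injective (algebraMap A R))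
    [Algebra.EssFiniteType A R]
    (p : Ideal R) [p.IsPrime]
    (hpA : ∀ a : A, algebraMap A R a ∈ p → a = 0)
    (FA : Type*) [Field FA] [Algebra A FA] [IsFractionRing A FA]
    (K : Type*) [Field K] [Algebra (R ⧸ p) K] [IsFractionRing (R ⧸ p) K]
    [Algebra R K] [IsScalarTower R (R ⧸ p) K] [Algebra A K] [IsScalarTower A R K]
    [Algebra FA K] [IsScalarTower A FA K]
    (hsep : IsSeparableFieldExtension FA K)
    (n : ℕ) (hn : 1 ≤ n) :
    ((Ideal.comap (algebraMap R (Localization.AtPrime p))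
        (Ideal.map (algebraMap R (Localization.AtPrime p)) (p ^ n)) : Ideal R) : Set R)
      = {f : R | ∀ δ ∈ DiffLE A R R (R ⧸ p) (n - 1), δ f = 0} := by
  obtain ⟨n, rfl⟩ : ∃ m, n = m + 1 := ⟨n - 1, by omega⟩
  rw [Nat.add_sub_cancel]
  ext f
  simp only [SetLike.mem_coe, Set.mem_ofPred_eq]
  constructor
  · intro hf
    obtain ⟨s, hs, hsf⟩ := (IsLocalization.algebraMap_mem_map_algebraMap_iff p.primeCompl
      (Localization.AtPrime p) (p ^ (n + 1)) f).1 (Ideal.mem_comap.1 hf)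
    exact DiffLE_cancel p s hs f n (fun δ hδ => DiffLE_pow p n δ hδ _ hsf)
  · intro hf
    by_contra hnot
    rw [Ideal.mem_comap] at hnot
    obtain ⟨δ, hδ, hδf⟩ := exists_operator p hpA FA K hsep n f hnot
    obtain ⟨δ', hδ', hδf'⟩ := exists_clear_denominators p K n δ hδ f hδf
    exact hδf' (hf δ' hδ')


end NoetherianOps
end

section
/- Let A be a Noetherian integral domain and R a Noetherian commutative ring containing A as a subring with R essentially of finite type over A, and suppose R is a formally smooth A-algebra. Let p be a prime ideal of R with p ∩ A = 0. Then for all n ≥ 1, p^{{n}_A} = p^{⟨n⟩_A}, where p^{{n}_A} = {f ∈ R | δ(f) = 0 for all δ ∈ Diff^{n-1}_{R/A}(R, R/p)} and p^{⟨n⟩_A} = {f ∈ R | δ(f) ∈ p for all δ ∈ Diff^{n-1}_{R/A}(R, R)}. -/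
set_option linter.unusedSectionVars false

open scoped TensorProduct

namespace NoetherianOps

section helpers

variable {A R N : Type*} [CommRing A] [CommRing R] [Algebra A R]
  [AddCommGroup N] [Module A N] [Module R N] [IsScalarTower A R N]

/-- Linear maps out of an augmented algebra killing `I ^ (n+1)` give operators of order `≤ n`. -/
lemma comp_mem_DiffLE {S : Type*} [CommRing S] [Algebra A S] [Algebra R S] [IsScalarTower A R S]
    (τ : R →ₐ[A] S) (I : Ideal S) (hI : ∀ r, τ r - algebraMap R S r ∈ I) (n : ℕ) :
    ∀ (L : S →ₗ[R] N), (∀ x ∈ I ^ (n + 1), L x = 0) →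
      (L.restrictScalars A).comp τ.toLinearMap ∈ DiffLE A R R N n := by
  have key : ∀ (L : S →ₗ[R] N) (r : R), opBracket A R R N r
      ((L.restrictScalars A).comp τ.toLinearMap) =
      ((L.comp (LinearMap.mulLeft R (τ r - algebraMap R S r))).restrictScalars A).comp
        τ.toLinearMap := by
    intro L r
    ext x
    simp [sub_mul, ← Algebra.smul_def]
  induction n with
  | zero =>
    intro L hL r
    rw [key]
    ext x
    simp only [LinearMap.comp_apply, LinearMap.restrictScalars_apply, LinearMap.mulLeft_apply,
      LinearMap.zero_apply]
    apply hL
    rw [zero_add, pow_one]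
    exact I.mul_mem_right _ (hI r)
  | succ n ih =>
    intro L hL r
    rw [key]
    apply ih
    intro x hx
    simp only [LinearMap.comp_apply, LinearMap.mulLeft_apply]
    apply hL
    rw [pow_succ']
    exact Ideal.mul_mem_mul (hI r) hx

/-- The linear map `a ⊗ f ↦ a • D f`. -/
noncomputable def opLift (D : R →ₗ[A] N) : R ⊗[A] R →ₗ[R] N :=
  TensorProduct.AlgebraTensorModule.lift
    ((LinearMap.toSpanSingleton R (R →ₗ[A] N) D))

@[simp] lemma opLift_tmul (D : R →ₗ[A] N) (a f : R) : opLift D (a ⊗ₜ f) = a • D f := by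
  simp [opLift]

lemma opLift_mul (D : R →ₗ[A] N) (r : R) (x : R ⊗[A] R) :
    opLift D ((1 ⊗ₜ r - r ⊗ₜ 1) * x) = opLift (opBracket A R R N r D) x := by
  induction x with
  | zero => simp
  | add x y hx hy => simp only [mul_add, map_add, hx, hy]
  | tmul a f =>
    simp [sub_mul, smul_sub, mul_smul, smul_comm r a]

lemma opLift_eq_zero (n : ℕ) : ∀ (D : R →ₗ[A] N), D ∈ DiffLE A R R N n →
    ∀ x ∈ (Ideal.span (Set.range fun r : R => (1 ⊗ₜ[A] r - r ⊗ₜ[A] 1 : R ⊗[A] R))) ^ (n + 1),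
      opLift D x = 0 := by
  have gen : ∀ (J : Ideal (R ⊗[A] R)) (D : R →ₗ[A] N),
      (∀ r, ∀ y ∈ J, opLift (opBracket A R R N r D) y = 0) →
      ∀ x ∈ (Ideal.span (Set.range fun r : R => (1 ⊗ₜ[A] r - r ⊗ₜ[A] 1 : R ⊗[A] R))) * J,
        opLift D x = 0 := by
    intro J D h x hx
    induction hx using Submodule.mul_induction_on' with
    | mem_mul_mem m hm y hy =>
      induction hm using Submodule.span_induction generalizing y with
      | mem m hm =>
        obtain ⟨r, rfl⟩ := hm
        rw [opLift_mul]
        exact h r y hy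
      | zero => simp
      | add a b _ _ ha hb => rw [add_mul, map_add, ha y hy, hb y hy, add_zero]
      | smul a b _ hb =>
        rw [smul_eq_mul, mul_comm a b, mul_assoc]
        exact hb _ (J.mul_mem_left _ hy)
    | add a _ b _ ha hb => rw [map_add, ha, hb, add_zero]
  induction n with
  | zero =>
    intro D hD x hx
    rw [pow_succ'] at hx
    refine gen _ D (fun r y _ => ?_) x hx
    rw [hD r]
    induction y with
    | zero => simp
    | add x y hx hy => rw [map_add, hx (by simp), hy (by simp), add_zero]
    | tmul a f => simp
  | succ n ih =>
    intro D hD x hx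
    rw [pow_succ'] at hx
    exact gen _ D (fun r y hy => ih _ (hD r) y hy) x hx

/-- An operator of order `≤ n` into a module killed by `K` vanishes on `K ^ (n+1)`. -/
lemma DiffLE_apply_eq_zero (K : Ideal R) (hK : ∀ k ∈ K, ∀ y : N, k • y = 0) (n : ℕ) :
    ∀ (D : R →ₗ[A] N), D ∈ DiffLE A R R N n → ∀ x ∈ K ^ (n + 1), D x = 0 := by
  have gen : ∀ (J : Ideal R) (D : R →ₗ[A] N),
      (∀ r, ∀ y ∈ J, opBracket A R R N r D y = 0) → ∀ x ∈ K * J, D x = 0 := by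
    intro J D h x hx
    induction hx using Submodule.mul_induction_on' with
    | mem_mul_mem m hm y hy =>
      have := h m y hy
      rw [opBracket_apply, hK m hm, sub_zero] at this
      exact this
    | add a _ b _ ha hb => rw [map_add, ha, hb, add_zero]
  induction n with
  | zero =>
    intro D hD x hx
    rw [pow_succ'] at hx
    refine gen _ D (fun r y _ => ?_) x hx
    rw [hD r, LinearMap.zero_apply]
  | succ n ih =>
    intro D hD x hx
    rw [pow_succ'] at hx
    exact gen _ D (fun r y hy => ih _ (hD r) y hy) x hx

lemma DiffLE_comp_left {N' : Type*} [AddCommGroup N'] [Module A N'] [Module R N']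
    [IsScalarTower A R N'] (q : N →ₗ[R] N') (n : ℕ) :
    ∀ D ∈ DiffLE A R R N n, (q.restrictScalars A).comp D ∈ DiffLE A R R N' n := by
  have key : ∀ (D : R →ₗ[A] N) (r : R), opBracket A R R N' r ((q.restrictScalars A).comp D) =
      (q.restrictScalars A).comp (opBracket A R R N r D) := by
    intro D r
    ext x
    simp
  induction n with
  | zero => intro D hD r; rw [key, hD r, LinearMap.comp_zero]
  | succ n ih => intro D hD r; rw [key]; exact ih _ (hD r)

end helpers

/-- Operators on a polynomial ring lift along surjections. -/
lemma exists_lift_mvPolynomial {A σ N N' : Type*} [CommRing A]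
    [AddCommGroup N] [Module A N] [Module (MvPolynomial σ A) N] [IsScalarTower A (MvPolynomial σ A) N]
    [AddCommGroup N'] [Module A N'] [Module (MvPolynomial σ A) N']
    [IsScalarTower A (MvPolynomial σ A) N']
    (q : N →ₗ[MvPolynomial σ A] N') (hq : Function.Surjective q) (n : ℕ)
    (D : MvPolynomial σ A →ₗ[A] N')
    (hD : D ∈ DiffLE A (MvPolynomial σ A) (MvPolynomial σ A) N' n) :
    ∃ D' ∈ DiffLE A (MvPolynomial σ A) (MvPolynomial σ A) N n, ∀ x, q (D' x) = D x := by
  classical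
  set P := MvPolynomial σ A with hP
  let τ : P →ₐ[A] MvPolynomial σ P :=
    MvPolynomial.aeval fun i => MvPolynomial.C (MvPolynomial.X i) + MvPolynomial.X i
  let ψ : MvPolynomial σ P →ₐ[P] P ⊗[A] P :=
    MvPolynomial.aeval fun i => 1 ⊗ₜ MvPolynomial.X i - MvPolynomial.X i ⊗ₜ 1
  have hψτ : ∀ f, ψ (τ f) = 1 ⊗ₜ f := by
    have : (ψ.restrictScalars A).comp τ = Algebra.TensorProduct.includeRight := by
      apply MvPolynomial.algHom_ext
      intro i
      simp [τ, ψ, ← MvPolynomial.algebraMap_eq]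
    intro f
    exact DFunLike.congr_fun this f
  let I : Ideal (MvPolynomial σ P) := MvPolynomial.idealOfVars σ P
  have hψI : I.map ψ ≤
      Ideal.span (Set.range fun r : P => (1 ⊗ₜ[A] r - r ⊗ₜ[A] 1 : P ⊗[A] P)) := by
    rw [show I = Ideal.span (Set.range MvPolynomial.X) from rfl, Ideal.map_span, Ideal.span_le]
    rintro _ ⟨_, ⟨i, rfl⟩, rfl⟩
    apply Ideal.subset_span
    exact ⟨MvPolynomial.X i, by simp [ψ]⟩
  let L : MvPolynomial σ P →ₗ[P] N' := (opLift D).comp ψ.toLinearMap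
  have hL : ∀ x ∈ I ^ (n + 1), L x = 0 := by
    intro x hx
    apply opLift_eq_zero n D hD
    apply Ideal.pow_right_mono hψI
    rw [← Ideal.map_pow]
    exact Ideal.mem_map_of_mem _ hx
  choose s hs using hq
  let L' : MvPolynomial σ P →ₗ[P] N := (MvPolynomial.basisMonomials σ P).constr P
    fun m => if m.degree ≤ n then s (L (MvPolynomial.monomial m 1)) else 0
  have hL'm : ∀ m, L' (MvPolynomial.monomial m 1) =
      if m.degree ≤ n then s (L (MvPolynomial.monomial m 1)) else 0 := by
    intro m
    have := (MvPolynomial.basisMonomials σ P).constr_basis P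
      (fun m => if m.degree ≤ n then s (L (MvPolynomial.monomial m 1)) else 0) m
    simpa [L'] using this
  have hqL : q.comp L' = L := by
    apply (MvPolynomial.basisMonomials σ P).ext
    intro m
    rw [MvPolynomial.coe_basisMonomials, LinearMap.comp_apply, hL'm]
    split_ifs with h
    · exact hs _
    · rw [map_zero, hL]
      rw [MvPolynomial.mem_pow_idealOfVars_iff]
      intro x hx
      have := MvPolynomial.support_monomial_subset hx
      rw [Finset.mem_singleton] at this
      subst this
      omega
  have hL'I : ∀ x ∈ I ^ (n + 1), L' x = 0 := by
    intro x hx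
    rw [MvPolynomial.mem_pow_idealOfVars_iff] at hx
    rw [x.as_sum, map_sum]
    refine Finset.sum_eq_zero fun m hm => ?_
    have hm' := hx m hm
    rw [← mul_one (x.coeff m), ← smul_eq_mul, ← MvPolynomial.smul_monomial, map_smul, hL'm,
      if_neg (by omega), smul_zero]
  refine ⟨(L'.restrictScalars A).comp τ.toLinearMap, comp_mem_DiffLE τ I ?_ n L' hL'I, ?_⟩
  · intro r
    induction r using MvPolynomial.induction_on with
    | C a =>
      have : τ (MvPolynomial.C a) = algebraMap P (MvPolynomial σ P) (MvPolynomial.C a) := by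
        rw [← MvPolynomial.algebraMap_eq, AlgHom.commutes,
          ← IsScalarTower.algebraMap_apply A P (MvPolynomial σ P)]
      rw [this, sub_self]
      exact zero_mem _
    | add a b ha hb =>
      rw [map_add, map_add, add_sub_add_comm]
      exact add_mem ha hb
    | mul_X a i ha =>
      have : τ (a * MvPolynomial.X i) - algebraMap P (MvPolynomial σ P) (a * MvPolynomial.X i) =
        (τ a - algebraMap P _ a) * τ (MvPolynomial.X i) +
          algebraMap P _ a * MvPolynomial.X i := by
        have hX : τ (MvPolynomial.X i) = algebraMap P (MvPolynomial σ P) (MvPolynomial.X i) +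
            MvPolynomial.X i := MvPolynomial.aeval_X _ i
        rw [map_mul, map_mul, hX]
        ring
      rw [this]
      refine add_mem (I.mul_mem_right _ ha) (I.mul_mem_left _ (Ideal.subset_span ⟨i, rfl⟩))
  · intro x
    have := LinearMap.congr_fun hqL (τ x)
    simp only [LinearMap.comp_apply, L] at this
    simp only [LinearMap.comp_apply, LinearMap.restrictScalars_apply, AlgHom.toLinearMap_apply,
      this, hψτ]
    simp

/-- The key lifting: via a polynomial presentation and formal smoothness. -/
lemma exists_lift_aux {A R P : Type*} [CommRing A] [CommRing R] [Algebra A R]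
    [Algebra.FormallySmooth A R] [CommRing P] [Algebra A P] [Algebra P R]
    [IsScalarTower A P R]
    (hs : Function.Surjective (algebraMap P R)) (p : Ideal R) (n : ℕ)
    (hlift : ∀ δ ∈ DiffLE A P P (R ⧸ p) n, ∃ E ∈ DiffLE A P P R n,
      ∀ x, Ideal.Quotient.mk p (E x) = δ x)
    (δ : R →ₗ[A] R ⧸ p) (hδ : δ ∈ DiffLE A R R (R ⧸ p) n) :
    ∃ D ∈ DiffLE A R R R n, ∀ x, Ideal.Quotient.mk p (D x) = δ x := by
  let π : P →ₐ[A] R := IsScalarTower.toAlgHom A P R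
  have hπs : Function.Surjective π := hs
  have h1 : ∀ n, ∀ δ ∈ DiffLE A R R (R ⧸ p) n,
      δ.comp π.toLinearMap ∈ DiffLE A P P (R ⧸ p) n := by
    have key : ∀ (δ : R →ₗ[A] R ⧸ p) (r : P), opBracket A P P (R ⧸ p) r
        (δ.comp π.toLinearMap) = (opBracket A R R (R ⧸ p) (π r) δ).comp π.toLinearMap := by
      intro δ r
      ext x : 1
      have : r • δ (π x) = π r • δ (π x) := (algebraMap_smul R r (δ (π x))).symm
      simp [this]
    intro n
    induction n with
    | zero => intro δ hδ r; rw [key, hδ (π r), LinearMap.zero_comp]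
    | succ n ih => intro δ hδ r; rw [key]; exact ih _ (hδ (π r))
  obtain ⟨E, hE, hqE⟩ := hlift _ (h1 n δ hδ)
  let K : Ideal P := RingHom.ker π
  have hEK : ∀ x ∈ K ^ (n + 1), E x = 0 := by
    refine DiffLE_apply_eq_zero K ?_ n E hE
    intro k hk y
    rw [Algebra.smul_def]
    have : algebraMap P R k = 0 := hk
    rw [this, zero_mul]
  -- section
  obtain ⟨s, hsec⟩ : ∃ s : R →ₐ[A] P ⧸ K ^ (n + 1), ∀ (r : R) (x : P),
      s r = Ideal.Quotient.mk _ x → π x = r := by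
    let g : P ⧸ K ^ (n + 1) →ₐ[A] R := Ideal.Quotient.liftₐ (K ^ (n + 1)) π
      (fun a ha => Ideal.pow_le_self (Nat.succ_ne_zero n) ha)
    have hgm : ∀ x : P, g (Ideal.Quotient.mk _ x) = π x := fun x => rfl
    have hg : Function.Surjective g := fun r => by
      obtain ⟨x, hx⟩ := hπs r
      exact ⟨Ideal.Quotient.mk _ x, by rw [hgm, hx]⟩
    have hker : RingHom.ker g ≤ K.map (Ideal.Quotient.mk (K ^ (n + 1))) := by
      intro y hy
      obtain ⟨x, rfl⟩ := Ideal.Quotient.mk_surjective y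
      exact Ideal.mem_map_of_mem _ (show π x = 0 from hy)
    have hnil : IsNilpotent (RingHom.ker g) := by
      refine ⟨n + 1, ?_⟩
      rw [Ideal.zero_eq_bot, eq_bot_iff]
      refine (Ideal.pow_right_mono hker _).trans ?_
      rw [← Ideal.map_pow, Ideal.map_quotient_self]
    refine ⟨Algebra.FormallySmooth.liftOfSurjective (AlgHom.id A R) g hg hnil, ?_⟩
    intro r x h
    rw [← hgm, ← h, Algebra.FormallySmooth.liftOfSurjective_apply]
    rfl
  let E' : (P ⧸ K ^ (n + 1)) →ₗ[A] R :=
    Submodule.liftQ ((K ^ (n + 1)).restrictScalars A) E hEK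
  have hE' : ∀ x : P, E' (Ideal.Quotient.mk _ x) = E x := fun x => rfl
  have h2 : ∀ n', ∀ (E : P →ₗ[A] R) (D : R →ₗ[A] R),
      (∀ r x, s r = Ideal.Quotient.mk _ x → D r = E x) →
      E ∈ DiffLE A P P R n' → D ∈ DiffLE A R R R n' := by
    have key : ∀ (E : P →ₗ[A] R) (D : R →ₗ[A] R),
      (∀ r x, s r = Ideal.Quotient.mk _ x → D r = E x) → ∀ (r : R) (y : P),
        s r = Ideal.Quotient.mk _ y → 
        ∀ a x, s a = Ideal.Quotient.mk _ x → opBracket A R R R r D a =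
          opBracket A P P R y E x := by
      intro E D h r y hy a x hx
      have e1 := hsec r y hy
      rw [opBracket_apply, opBracket_apply, h a x hx, h (r • a) (y • x)
        (by simp [hx, hy])]
      congr 1
      rw [Algebra.smul_def y, ← e1]
      rfl
    intro n'
    induction n' with
    | zero =>
      intro E D h hE r
      obtain ⟨y, hy⟩ := Ideal.Quotient.mk_surjective (s r)
      ext a
      obtain ⟨x, hx⟩ := Ideal.Quotient.mk_surjective (s a)
      rw [key E D h r y hy.symm a x hx.symm, hE y]
      rfl
    | succ n ih =>
      intro E D h hE r
      obtain ⟨y, hy⟩ := Ideal.Quotient.mk_surjective (s r)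
      exact ih _ _ (key E D h r y hy.symm) (hE y)
  refine ⟨E'.comp s.toLinearMap, h2 n E _ ?_ hE, ?_⟩
  · intro r x h
    rw [LinearMap.comp_apply, AlgHom.toLinearMap_apply, h, hE']
  · intro r
    obtain ⟨x, hx⟩ := Ideal.Quotient.mk_surjective (s r)
    rw [LinearMap.comp_apply, AlgHom.toLinearMap_apply, ← hx, hE']
    have := hqE x
    rw [LinearMap.comp_apply, AlgHom.toLinearMap_apply, hsec r x hx.symm] at this
    exact this

/-- **The two differential powers agree in the formally smooth case** (Theorem 4.6(iii)).
If `R` is moreover a formally smooth `A`-algebra, then for all `n ≥ 1`,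
`p^{{n}_A} = {f ∣ δ f = 0 for all δ ∈ Diffⁿ⁻¹_{R/A}(R, R/p)}` equals
`p^{⟨n⟩_A} = {f ∣ δ f ∈ p for all δ ∈ Diffⁿ⁻¹_{R/A}(R, R)}`. -/
theorem diffPower_eq_diffPower'_formallySmooth
    (A R : Type u) [CommRing A] [CommRing R] [IsDomain A]
    [IsNoetherianRing A] [IsNoetherianRing R] [Algebra A R]
    (hAR : Function.Injective (algebraMap A R))
    [Algebra.EssFiniteType A R] [Algebra.FormallySmooth A R]
    (p : Ideal R) [p.IsPrime]
    (hpA : ∀ a : A, algebraMap A R a ∈ p → a = 0)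
    (n : ℕ) (hn : 1 ≤ n) :
    {f : R | ∀ δ ∈ DiffLE A R R (R ⧸ p) (n - 1), δ f = 0}
      = {f : R | ∀ δ ∈ DiffLE A R R R (n - 1), δ f ∈ p} := by
  ext f
  constructor
  · intro hf δ hδ
    have := hf _ (DiffLE_comp_left (A := A) (Submodule.mkQ p) _ δ hδ)
    exact (Submodule.Quotient.mk_eq_zero p).1 this
  · intro hf δ hδ
    let _ : Algebra (MvPolynomial R A) R := (MvPolynomial.aeval (R := A) (id : R → R)).toAlgebra
    have _ : IsScalarTower A (MvPolynomial R A) R :=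
      IsScalarTower.of_algebraMap_eq fun a => (AlgHom.commutes (MvPolynomial.aeval id) a).symm
    obtain ⟨D, hD, h⟩ := exists_lift_aux (P := MvPolynomial R A) (A := A) (R := R)
      (fun r => ⟨MvPolynomial.X r, MvPolynomial.aeval_X _ _⟩) p (n - 1)
      (fun δ' hδ' => exists_lift_mvPolynomial
        (IsScalarTower.toAlgHom (MvPolynomial R A) R (R ⧸ p)).toLinearMap
        Ideal.Quotient.mk_surjective (n - 1) δ' hδ') δ hδ
    rw [← h f]
    exact Ideal.Quotient.eq_zero_iff_mem.2 (hf D hD)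

end NoetherianOps
end

section
/- Let R be a commutative ring, A a subring of R, and M, N two R-modules. Let Δ ⊆ R ⊗_A R be the kernel of the multiplication map μ: R ⊗_A R → R, r ⊗ s ↦ rs. Then for every n ≥ 0, Diff^n_{R/A}(M, N) is exactly the set of δ ∈ Hom_A(M, N) annihilated by Δ^{n+1} under the (R ⊗_A R)-module structure of Hom_A(M, N); that is, δ ∈ Diff^n_{R/A}(M,N) if and only if θ·δ = 0 for every θ ∈ Δ^{n+1}. -/
set_option linter.unusedSectionVars false

open scoped TensorProduct

namespace NoetherianOps

section HomAction

variable (A R M N : Type*) [CommRing A] [CommRing R] [Algebra A R]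
  [AddCommGroup M] [Module A M] [Module R M] [IsScalarTower A R M]
  [AddCommGroup N] [Module A N] [Module R N] [IsScalarTower A R N]

/-- Pre-composition with scalar multiplication, as an `A`-linear map
`R →ₗ[A] End_A (Hom_A(M, N))`; this is the action of the right tensor factor of
`R ⊗[A] R` on `Hom_A(M, N)`. -/
def preEnd : R →ₗ[A] (M →ₗ[A] N) →ₗ[A] (M →ₗ[A] N) where
  toFun s := LinearMap.lcomp A N (s • (LinearMap.id : M →ₗ[A] M))
  map_add' s t := by
    ext δ m
    simp [add_smul]
  map_smul' a s := by
    ext δ m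
    simp [smul_assoc]

/-- The canonical action of `R ⊗[A] R` on `Hom_A(M, N)`, characterized by
`homAct (r ⊗ₜ s) δ = (m ↦ r • δ (s • m))`; this is the `(R ⊗[A] R)`-module structure
`((r ⊗ s) δ)(m) = r δ(s m)` on `Hom_A(M, N)`. -/
noncomputable def homAct : (R ⊗[A] R) →ₗ[A] (M →ₗ[A] N) →ₗ[A] (M →ₗ[A] N) :=
  TensorProduct.lift
    { toFun := fun r => r • preEnd A R M N
      map_add' := fun r s => by simp [add_smul]
      map_smul' := fun a r => by simp [smul_assoc] }

@[simp] lemma homAct_tmul_apply (r s : R) (δ : M →ₗ[A] N) (m : M) :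
    homAct A R M N (r ⊗ₜ[A] s) δ m = r • δ (s • m) := rfl

end HomAction

end NoetherianOps
namespace NoetherianOps

section Helpers

variable {A R M N : Type*} [CommRing A] [CommRing R] [Algebra A R]
  [AddCommGroup M] [Module R M] [Module A M] [IsScalarTower A R M]
  [AddCommGroup N] [Module R N] [Module A N] [IsScalarTower A R N]

/-- `homAct` is multiplicative. -/
lemma homAct_mul_apply (x y : R ⊗[A] R) (δ : M →ₗ[A] N) :
    homAct A R M N (x * y) δ = homAct A R M N x (homAct A R M N y δ) := by
  induction x using TensorProduct.induction_on with
  | zero => simp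
  | add x₁ x₂ h₁ h₂ => simp [add_mul, h₁, h₂]
  | tmul a b =>
    induction y using TensorProduct.induction_on with
    | zero => simp
    | add y₁ y₂ h₁ h₂ => simp [mul_add, h₁, h₂]
    | tmul c d =>
      ext m
      simp [Algebra.TensorProduct.tmul_mul_tmul, mul_smul, smul_comm b d m]

lemma homAct_one_apply (δ : M →ₗ[A] N) : homAct A R M N 1 δ = δ := by
  ext m
  simp [Algebra.TensorProduct.one_def]

lemma homAct_bracket (r : R) (δ : M →ₗ[A] N) :
    homAct A R M N ((1 : R) ⊗ₜ[A] r - r ⊗ₜ[A] (1 : R)) δ = opBracket A R M N r δ := by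
  ext m
  simp

/-- Killing all brackets by `J` is the same as killing the operator by `J * Δ`. -/
lemma killed_step (J : Ideal (R ⊗[A] R)) (δ : M →ₗ[A] N) :
    (∀ r : R, ∀ θ ∈ J, homAct A R M N θ (opBracket A R M N r δ) = 0) ↔
      ∀ θ ∈ J * RingHom.ker (Algebra.TensorProduct.lmul' (S := R) A),
        homAct A R M N θ δ = 0 := by
  constructor
  · intro h θ hθ
    have key : ∀ y ∈ RingHom.ker (Algebra.TensorProduct.lmul' (S := R) A),
        ∀ x ∈ J, homAct A R M N (x * y) δ = 0 := by
      intro y hy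
      have hy' : y ∈ Ideal.span
          (Set.range fun s : R => (1 : R) ⊗ₜ[A] s - s ⊗ₜ[A] (1 : R)) := by
        rw [KaehlerDifferential.span_range_eq_ideal]
        exact hy
      clear hy
      induction hy' using Submodule.span_induction with
      | mem y hy =>
        obtain ⟨r, rfl⟩ := hy
        intro x hx
        rw [homAct_mul_apply, homAct_bracket]
        exact h r x hx
      | zero => simp
      | add y z hy hz h₁ h₂ =>
        intro x hx
        rw [mul_add, map_add, LinearMap.add_apply, h₁ x hx, h₂ x hx, add_zero]
      | smul a y hy h₁ =>
        intro x hx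
        rw [smul_eq_mul, ← mul_assoc]
        exact h₁ (x * a) (J.mul_mem_right a hx)
    induction hθ using Submodule.mul_induction_on' with
    | mem_mul_mem x hx y hy => exact key y hy x hx
    | add x _ y _ hx hy => rw [map_add, LinearMap.add_apply, hx, hy, add_zero]
  · intro h r θ hθ
    rw [← homAct_bracket, ← homAct_mul_apply]
    exact h _ (Ideal.mul_mem_mul hθ
      (KaehlerDifferential.one_smul_sub_smul_one_mem_ideal A r))

end Helpers

/-- **Differential operators are the elements annihilated by powers of the diagonal ideal**
(Proposition 2.3).  Let `R` be a commutative ring, `A ⊆ R` a subring and `M`, `N` two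
`R`-modules.  Let `Δ ⊆ R ⊗[A] R` be the kernel of the multiplication map
`R ⊗[A] R → R`.  Then `δ ∈ Diffⁿ_{R/A}(M, N)` iff `θ • δ = 0` for every `θ ∈ Δ^{n+1}`,
where `R ⊗[A] R` acts on `Hom_A(M, N)` via `((r ⊗ s) • δ) (m) = r • δ (s • m)`
(the action `homAct`). -/
theorem diffLE_iff_killed_by_diagonal_power
    (A R : Type*) [CommRing A] [CommRing R] [Algebra A R]
    (hAR : Function.Injective (algebraMap A R))
    (M N : Type*) [AddCommGroup M] [Module R M] [Module A M] [IsScalarTower A R M]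
    [AddCommGroup N] [Module R N] [Module A N] [IsScalarTower A R N]
    (n : ℕ) (δ : M →ₗ[A] N) :
    δ ∈ DiffLE A R M N n ↔
      ∀ θ ∈ (RingHom.ker (Algebra.TensorProduct.lmul' (S := R) A)) ^ (n + 1),
        homAct A R M N θ δ = 0 := by
  induction n generalizing δ with
  | zero =>
    rw [pow_succ, ← killed_step]
    constructor
    · intro h r θ _
      rw [h r, map_zero]
    · intro h r
      have := h r 1 (by simp)
      rwa [homAct_one_apply] at this
  | succ n ih =>
    rw [pow_succ, ← killed_step]
    exact forall_congr' fun r => ih _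

end NoetherianOps
end

section
/- Let R be a commutative ring, A a subring of R, M, N two R-modules, and n ≥ 0. Let Δ ⊆ R ⊗_A R be the kernel of the multiplication map R ⊗_A R → R, define the module of n-th principal parts P^n_{R/A}(M) = (R ⊗_A M)/Δ^{n+1}(R ⊗_A M) (an R-module via the left factor), and let d^n: M → P^n_{R/A}(M) send m to the class of 1 ⊗ m. Then the map φ ↦ φ ∘ d^n is an isomorphism of R-modules Hom_R(P^n_{R/A}(M), N) ≅ Diff^n_{R/A}(M, N). -/
set_option linter.unusedSectionVars false

open scoped TensorProduct

namespace NoetherianOps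

section DiagAction

variable (A R M : Type*) [CommRing A] [CommRing R] [Algebra A R]
  [AddCommGroup M] [Module A M] [Module R M] [IsScalarTower A R M]

/-- The action of the right tensor factor of `R ⊗[A] R` on `R ⊗[A] M`, as an `A`-linear map
`R →ₗ[A] End_A (R ⊗[A] M)`; `s` acts by `t ⊗ m ↦ t ⊗ (s • m)`. -/
noncomputable def rightEnd : R →ₗ[A] (R ⊗[A] M) →ₗ[A] (R ⊗[A] M) where
  toFun s := LinearMap.lTensor R (s • (LinearMap.id : M →ₗ[A] M))
  map_add' s t := by simp only [add_smul, LinearMap.lTensor_add]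
  map_smul' a s := by simp only [smul_assoc, LinearMap.lTensor_smul, RingHom.id_apply]

/-- The canonical action of `R ⊗[A] R` on `R ⊗[A] M`, characterized by
`diagAct (r ⊗ₜ s) (t ⊗ₜ m) = (r * t) ⊗ₜ (s • m)`; this is the `(R ⊗[A] R)`-module
structure of `R ⊗[A] M`. -/
noncomputable def diagAct : (R ⊗[A] R) →ₗ[A] (R ⊗[A] M) →ₗ[A] (R ⊗[A] M) :=
  TensorProduct.lift
    { toFun := fun r => r • rightEnd A R M
      map_add' := fun r s => by simp [add_smul]
      map_smul' := fun a r => by simp [smul_assoc] }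

@[simp] lemma diagAct_tmul_tmul (r s t : R) (m : M) :
    diagAct A R M (r ⊗ₜ[A] s) (t ⊗ₜ[A] m) = (r * t) ⊗ₜ[A] (s • m) := by
  simp [diagAct, rightEnd, TensorProduct.smul_tmul']

/-- The submodule `Δ^{n+1} (R ⊗[A] M)` of `R ⊗[A] M`, where `Δ ⊆ R ⊗[A] R` is the kernel
of the multiplication map `R ⊗[A] R → R`: the `R`-submodule generated by all elements
`θ • y` with `θ ∈ Δ^{n+1}` and `y ∈ R ⊗[A] M`.  The quotient
`(R ⊗[A] M) / Δ^{n+1}(R ⊗[A] M)` is the module of `n`-th principal parts `P^n_{R/A}(M)`. -/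
noncomputable def principalPartsKer (n : ℕ) : Submodule R (R ⊗[A] M) :=
  Submodule.span R
    {x | ∃ θ ∈ (RingHom.ker (Algebra.TensorProduct.lmul' (S := R) A)) ^ (n + 1),
      ∃ y : R ⊗[A] M, x = diagAct A R M θ y}

end DiagAction

end NoetherianOps
namespace NoetherianOps

section Aux

variable {A R M N : Type*} [CommRing A] [CommRing R] [Algebra A R]
  [AddCommGroup M] [Module R M] [Module A M] [IsScalarTower A R M]
  [AddCommGroup N] [Module R N] [Module A N] [IsScalarTower A R N]

lemma diagAct_mul (a b : R ⊗[A] R) (y : R ⊗[A] M) :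
    diagAct A R M (a * b) y = diagAct A R M a (diagAct A R M b y) := by
  induction y with
  | zero => simp
  | add x y hx hy => simp only [map_add, hx, hy]
  | tmul t m =>
    induction b with
    | zero => simp
    | add x y hx hy => simp only [mul_add, map_add, LinearMap.add_apply, hx, hy]
    | tmul r s =>
      induction a with
      | zero => simp
      | add x y hx hy => simp only [add_mul, map_add, LinearMap.add_apply, hx, hy]
      | tmul p q => simp [mul_assoc, mul_smul]

lemma diagAct_one (y : R ⊗[A] M) : diagAct A R M 1 y = y := by
  induction y with
  | zero => simp
  | add x y hx hy => simp only [map_add, hx, hy]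
  | tmul t m => simp [Algebra.TensorProduct.one_def]

lemma ext_bracket (r : R) (δ : M →ₗ[A] N) (y : R ⊗[A] M) :
    (opBracket A R M N r δ).liftBaseChange R y =
      δ.liftBaseChange R (diagAct A R M (1 ⊗ₜ[A] r - r ⊗ₜ[A] 1) y) := by
  induction y with
  | zero => simp
  | add x y hx hy => simp only [map_add, hx, hy]
  | tmul t m => simp [smul_sub, mul_smul, smul_comm t r]

/-- `δ` extended to `R ⊗ M` kills `I (R ⊗ M)`. -/
def Kills (I : Ideal (R ⊗[A] R)) (δ : M →ₗ[A] N) : Prop :=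
  ∀ θ ∈ I, ∀ y : R ⊗[A] M, δ.liftBaseChange R (diagAct A R M θ y) = 0

lemma kills_top (δ : M →ₗ[A] N) : Kills (R := R) ⊤ δ ↔ δ = 0 := by
  constructor
  · intro h
    ext m
    simpa [diagAct_one] using h 1 trivial (1 ⊗ₜ m)
  · rintro rfl θ - y
    have : (0 : M →ₗ[A] N).liftBaseChange R = 0 := by ext; simp
    rw [this]; rfl

lemma kills_mul (I : Ideal (R ⊗[A] R)) (δ : M →ₗ[A] N) :
    Kills (RingHom.ker (Algebra.TensorProduct.lmul' (S := R) A) * I) δ ↔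
      ∀ r : R, Kills I (opBracket A R M N r δ) := by
  constructor
  · intro h r θ hθ y
    rw [ext_bracket, ← diagAct_mul]
    refine h _ (Ideal.mul_mem_mul ?_ hθ) y
    simp [RingHom.mem_ker]
  · intro h θ hθ y
    induction hθ using Submodule.mul_induction_on' with
    | add x _ z _ hx hz => simp only [map_add, LinearMap.add_apply, hx, hz, add_zero]
    | mem_mul_mem a ha b hb =>
      have ha' : a ∈ Ideal.span (Set.range fun s : R => (1 : R) ⊗ₜ[A] s - s ⊗ₜ[A] (1 : R)) := by
        rw [KaehlerDifferential.span_range_eq_ideal]; exact ha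
      clear ha
      induction ha' using Submodule.span_induction generalizing b with
      | mem x hx =>
        obtain ⟨r, rfl⟩ := hx
        rw [diagAct_mul, ← ext_bracket]
        exact h r b hb y
      | zero => simp
      | add x z _ _ hx hz =>
        simp only [add_mul, map_add, LinearMap.add_apply, hx b hb, hz b hb, add_zero]
      | smul c x _ hx =>
        have := hx (c * b) (I.mul_mem_left c hb)
        rwa [show c • x * b = x * (c * b) by rw [smul_eq_mul]; ring]

lemma mem_diffLE_iff (n : ℕ) (δ : M →ₗ[A] N) :
    δ ∈ DiffLE A R M N n ↔
      Kills (RingHom.ker (Algebra.TensorProduct.lmul' (S := R) A) ^ (n + 1)) δ := by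
  induction n generalizing δ with
  | zero =>
    rw [pow_succ', pow_zero, Ideal.one_eq_top, kills_mul]
    simp only [kills_top]
    rfl
  | succ n ih =>
    rw [pow_succ', kills_mul]
    simp only [← ih]
    rfl

end Aux

/-- **Representability of differential operators by the module of principal parts**
(Proposition 2.6).  Let `R` be a commutative ring, `A ⊆ R` a subring, `M`, `N` two
`R`-modules and `n ≥ 0`.  Let `P = (R ⊗[A] M) / Δ^{n+1}(R ⊗[A] M)` be the module of `n`-th
principal parts (an `R`-module via the left factor) and `dⁿ : M → P`, `m ↦ [1 ⊗ m]`.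
Then `φ ↦ φ ∘ dⁿ` is an `R`-module isomorphism `Hom_R(P, N) ≅ Diffⁿ_{R/A}(M, N)`:
it is injective, additive, `R`-homogeneous, and its range is exactly `Diffⁿ_{R/A}(M, N)`. -/
theorem homPrincipalParts_equiv_diffLE
    (A R : Type*) [CommRing A] [CommRing R] [Algebra A R]
    (hAR : Function.Injective (algebraMap A R))
    (M N : Type*) [AddCommGroup M] [Module R M] [Module A M] [IsScalarTower A R M]
    [AddCommGroup N] [Module R N] [Module A N] [IsScalarTower A R N]
    (n : ℕ) :
    ∃ F : (((R ⊗[A] M) ⧸ principalPartsKer A R M n) →ₗ[R] N) → (M →ₗ[A] N),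
      (∀ φ (m : M),
        F φ m = φ (Submodule.Quotient.mk ((1 : R) ⊗ₜ[A] m))) ∧
      (∀ φ ψ, F (φ + ψ) = F φ + F ψ) ∧
      (∀ (r : R) (φ), F (r • φ) = r • F φ) ∧
      Function.Injective F ∧
      Set.range F = DiffLE A R M N n := by
  have key : ∀ φ : ((R ⊗[A] M) ⧸ principalPartsKer A R M n) →ₗ[R] N,
      LinearMap.liftBaseChange R ((((φ ∘ₗ (principalPartsKer A R M n).mkQ).restrictScalars A) ∘ₗ
        (TensorProduct.mk A R M 1))) = φ ∘ₗ (principalPartsKer A R M n).mkQ := by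
    intro φ
    ext m
    simp
  refine ⟨fun φ => ((φ ∘ₗ (principalPartsKer A R M n).mkQ).restrictScalars A) ∘ₗ
    (TensorProduct.mk A R M 1), fun φ m => rfl, fun φ ψ => rfl, fun r φ => rfl, ?_, ?_⟩
  · intro φ ψ h
    have h2 := congrArg (LinearMap.liftBaseChange R) h
    simp only [key] at h2
    exact Submodule.linearMap_qext _ h2
  · ext δ
    rw [mem_diffLE_iff]
    constructor
    · rintro ⟨φ, rfl⟩ θ hθ y
      simp only [key]
      have : diagAct A R M θ y ∈ principalPartsKer A R M n :=
        Submodule.subset_span ⟨θ, hθ, y, rfl⟩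
      rw [LinearMap.comp_apply, Submodule.mkQ_apply,
        (Submodule.Quotient.mk_eq_zero _).2 this, map_zero]
    · intro h
      refine ⟨(principalPartsKer A R M n).liftQ (δ.liftBaseChange R) ?_, ?_⟩
      · refine Submodule.span_le.2 ?_
        rintro _ ⟨θ, hθ, y, rfl⟩
        exact h θ hθ y
      · ext m
        change δ.liftBaseChange R ((1 : R) ⊗ₜ[A] m) = δ m
        simp

end NoetherianOps
end

section
/- Let R be a commutative ring, A a subring of R, W ⊆ R a multiplicatively closed subset, M an R-module, and N a module over W^{-1}R. Then for every n ≥ 0 there are isomorphisms of R-modules Diff^n_{R/A}(M, N) ≅ Diff^n_{W^{-1}R/A}(W^{-1}M, N) ≅ Diff^n_{W^{-1}R/(W∩A)^{-1}A}(W^{-1}M, N). -/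
set_option linter.unusedSectionVars false

open scoped TensorProduct

namespace NoetherianOps

section Basic

variable {A R M N : Type*} [CommRing A] [CommRing R] [Algebra A R]
  [AddCommGroup M] [Module A M] [Module R M] [IsScalarTower A R M]
  [AddCommGroup N] [Module A N] [Module R N] [IsScalarTower A R N]

lemma opBracket_sub' (r : R) (δ ε : M →ₗ[A] N) :
    opBracket A R M N r (δ - ε) = opBracket A R M N r δ - opBracket A R M N r ε := by
  ext m; simp [smul_sub]; abel

lemma opBracket_pre (r w : R) (δ : M →ₗ[A] N) :
    opBracket A R M N r (preSMul A R M N w δ) = preSMul A R M N w (opBracket A R M N r δ) := by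
  ext m; simp [smul_comm r w m]

lemma zero_mem_DiffLE (n : ℕ) : (0 : M →ₗ[A] N) ∈ DiffLE A R M N n := by
  induction n with
  | zero => intro r; ext m; simp
  | succ n ih =>
    intro r
    have : opBracket A R M N r (0 : M →ₗ[A] N) = 0 := by ext m; simp
    rw [this]; exact ih

lemma DiffLE_succ {n : ℕ} {δ : M →ₗ[A] N} (h : δ ∈ DiffLE A R M N n) :
    δ ∈ DiffLE A R M N (n + 1) := by
  induction n generalizing δ with
  | zero => intro r; rw [h r]; exact zero_mem_DiffLE 0
  | succ n ih => intro r; exact ih (h r)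

lemma sub_mem_DiffLE {n : ℕ} {δ ε : M →ₗ[A] N} (h : δ ∈ DiffLE A R M N n)
    (h' : ε ∈ DiffLE A R M N n) : δ - ε ∈ DiffLE A R M N n := by
  induction n generalizing δ ε with
  | zero => intro r; rw [opBracket_sub', h r, h' r, sub_zero]
  | succ n ih => intro r; rw [opBracket_sub']; exact ih (h r) (h' r)

lemma pre_mem_DiffLE {n : ℕ} (w : R) {δ : M →ₗ[A] N} (h : δ ∈ DiffLE A R M N n) :
    preSMul A R M N w δ ∈ DiffLE A R M N n := by
  induction n generalizing δ with
  | zero => intro r; rw [opBracket_pre, h r]; ext m; simp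
  | succ n ih => intro r; rw [opBracket_pre]; exact ih (h r)

variable {Rw : Type*} [CommRing Rw] [Algebra R Rw] [Algebra A Rw]
  [Module Rw N] [IsScalarTower R Rw N] [IsScalarTower A Rw N]

lemma opBracket_smul' (r : R) (c : Rw) (δ : M →ₗ[A] N) :
    opBracket A R M N r (c • δ) = c • opBracket A R M N r δ := by
  ext m; simp [smul_sub, smul_comm r c]

lemma smul_mem_DiffLE {n : ℕ} (c : Rw) {δ : M →ₗ[A] N} (h : δ ∈ DiffLE A R M N n) :
    c • δ ∈ DiffLE A R M N n := by
  induction n generalizing δ with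
  | zero => intro r; rw [opBracket_smul', h r, smul_zero]
  | succ n ih => intro r; rw [opBracket_smul']; exact ih (h r)

/-- Precomposition with an element acting invertibly on the target is injective. -/
lemma pre_inj_zero {n : ℕ} {w : R} {c : Rw} (hc : c * algebraMap R Rw w = 1)
    {δ : M →ₗ[A] N} (h : δ ∈ DiffLE A R M N n) (h0 : preSMul A R M N w δ = 0) : δ = 0 := by
  have key : ∀ r, opBracket A R M N r δ = 0 := by
    induction n generalizing δ with
    | zero => exact h
    | succ n ih =>
      intro r
      have h1 : preSMul A R M N w (opBracket A R M N r δ) = 0 := by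
        rw [← opBracket_pre, h0]; ext m; simp
      have h2 := ih (h r) h1
      ext m
      have h3 := LinearMap.congr_fun (h2 w) m
      have h4 := LinearMap.congr_fun h1 m
      simp only [opBracket_apply, preSMul_apply, LinearMap.zero_apply] at h3 h4 ⊢
      rw [h4, zero_sub, neg_eq_zero] at h3
      rw [← one_smul Rw (δ (r • m) - r • δ m), ← hc, mul_smul, algebraMap_smul, h3, smul_zero]
  ext m
  have h3 := LinearMap.congr_fun (key w) m
  have h4 := LinearMap.congr_fun h0 m
  simp only [opBracket_apply, preSMul_apply, LinearMap.zero_apply] at h3 h4 ⊢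
  rw [h4, zero_sub, neg_eq_zero] at h3
  rw [← one_smul Rw (δ m), ← hc, mul_smul, algebraMap_smul, h3, smul_zero]

lemma pre_inj {n : ℕ} {w : R} {c : Rw} (hc : c * algebraMap R Rw w = 1)
    {δ ε : M →ₗ[A] N} (h : δ ∈ DiffLE A R M N n) (h' : ε ∈ DiffLE A R M N n)
    (h0 : preSMul A R M N w δ = preSMul A R M N w ε) : δ = ε := by
  rw [← sub_eq_zero]
  refine pre_inj_zero hc (sub_mem_DiffLE h h') ?_
  ext m
  have := LinearMap.congr_fun h0 m
  simpa [sub_eq_zero] using this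

/-- Precomposition with an element acting invertibly on the target is surjective. -/
lemma pre_surj {n : ℕ} {w : R} {c : Rw} (hc : c * algebraMap R Rw w = 1)
    {δ : M →ₗ[A] N} (h : δ ∈ DiffLE A R M N n) :
    ∃ ε ∈ DiffLE A R M N n, preSMul A R M N w ε = δ := by
  have hcx : ∀ x : N, c • w • x = x := fun x => by
    rw [← algebraMap_smul Rw w x, ← mul_smul, hc, one_smul]
  induction n generalizing δ with
  | zero =>
    refine ⟨c • δ, smul_mem_DiffLE c h, ?_⟩
    ext m
    have h3 := LinearMap.congr_fun (h w) m
    simp only [opBracket_apply, LinearMap.zero_apply, sub_eq_zero] at h3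
    simp [h3, hcx]
  | succ n ih =>
    obtain ⟨η, hη, he⟩ := ih (smul_mem_DiffLE c (h w))
    refine ⟨c • δ - η, sub_mem_DiffLE (smul_mem_DiffLE c h) (DiffLE_succ hη), ?_⟩
    ext m
    have h3 := LinearMap.congr_fun he m
    simp only [preSMul_apply, LinearMap.smul_apply, opBracket_apply, smul_sub, hcx] at h3
    simp [h3]

end Basic

section Loc

variable {A R : Type*} [CommRing A] [CommRing R] [Algebra A R]
    {W : Submonoid R}
    {M N : Type*} [AddCommGroup M] [Module R M] [Module A M] [IsScalarTower A R M]
    [AddCommGroup N] [Module R N] [Module A N] [IsScalarTower A R N]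
    {Rw : Type*} [CommRing Rw] [Algebra R Rw]
    [Algebra A Rw] [IsScalarTower A R Rw]
    {Mw : Type*} [AddCommGroup Mw] [Module R Mw] [Module Rw Mw] [IsScalarTower R Rw Mw]
    [Module A Mw] [IsScalarTower A R Mw] [IsScalarTower A Rw Mw]
    [Module Rw N] [IsScalarTower R Rw N] [IsScalarTower A Rw N]

lemma exists_inv (W : Submonoid R) (Rw : Type*) [CommRing Rw] [Algebra R Rw]
    [IsLocalization W Rw] {w : R} (hw : w ∈ W) : ∃ c : Rw, c * algebraMap R Rw w = 1 :=
  (IsLocalization.map_units Rw (⟨w, hw⟩ : W)).exists_left_inv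

lemma DiffLE_of_Rw {n : ℕ} {δ : Mw →ₗ[A] N} (h : δ ∈ DiffLE A Rw Mw N n) :
    δ ∈ DiffLE A R Mw N n := by
  have hb : ∀ (r : R) (δ : Mw →ₗ[A] N),
      opBracket A R Mw N r δ = opBracket A Rw Mw N (algebraMap R Rw r) δ := by
    intro r δ; ext m; simp [algebraMap_smul]
  induction n generalizing δ with
  | zero => intro r; rw [hb]; exact h _
  | succ n ih => intro r; rw [hb]; exact ih (h _)

lemma pre_bracket {w r : R} {s : Rw} (hs : algebraMap R Rw w * s = algebraMap R Rw r)
    (δ : Mw →ₗ[A] N) :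
    preSMul A R Mw N w (opBracket A Rw Mw N s δ)
      = opBracket A R Mw N r δ - s • opBracket A R Mw N w δ := by
  have h1 : ∀ m : Mw, s • w • m = r • m := fun m => by
    rw [← algebraMap_smul Rw w m, ← algebraMap_smul Rw r m, ← mul_smul, mul_comm, hs]
  have h2 : ∀ m : N, s • w • m = r • m := fun m => by
    rw [← algebraMap_smul Rw w m, ← algebraMap_smul Rw r m, ← mul_smul, mul_comm, hs]
  ext m
  simp [smul_sub, h1, h2]

lemma DiffLE_to_Rw (W : Submonoid R) [IsLocalization W Rw]
    {n : ℕ} {δ : Mw →ₗ[A] N} (h : δ ∈ DiffLE A R Mw N n) :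
    δ ∈ DiffLE A Rw Mw N n := by
  have cancel : ∀ (w : R), w ∈ W → ∀ δ ε : Mw →ₗ[A] N,
      preSMul A R Mw N w δ = preSMul A R Mw N w ε → δ = ε := by
    intro w hw δ ε he
    obtain ⟨c, hc⟩ := exists_inv W Rw hw
    ext m
    have := LinearMap.congr_fun he (c • m)
    simp only [preSMul_apply] at this
    rwa [← algebraMap_smul Rw w (c • m), ← mul_smul, mul_comm, hc, one_smul] at this
  induction n generalizing δ with
  | zero =>
    intro s
    obtain ⟨⟨r, w⟩, hs⟩ := IsLocalization.surj W s
    rw [mul_comm] at hs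
    refine cancel w w.2 _ _ ?_
    rw [pre_bracket hs, h r, h w]
    ext m; simp
  | succ n ih =>
    intro s
    obtain ⟨⟨r, w⟩, hs⟩ := IsLocalization.surj W s
    rw [mul_comm] at hs
    obtain ⟨c, hc⟩ := exists_inv W Rw w.2
    apply ih
    obtain ⟨ε, hε, he⟩ := pre_surj (n := n) hc
      (sub_mem_DiffLE (h r) (smul_mem_DiffLE s (h w)))
    rw [← pre_bracket hs] at he
    rw [← cancel w w.2 _ _ he]
    exact hε

lemma comp_mem (f : M →ₗ[R] Mw) {n : ℕ} {δ : Mw →ₗ[A] N} (h : δ ∈ DiffLE A R Mw N n) :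
    δ.comp (f.restrictScalars A) ∈ DiffLE A R M N n := by
  have hb : ∀ (r : R) (δ : Mw →ₗ[A] N),
      opBracket A R M N r (δ.comp (f.restrictScalars A))
        = (opBracket A R Mw N r δ).comp (f.restrictScalars A) := by
    intro r δ; ext m; simp
  induction n generalizing δ with
  | zero => intro r; rw [hb, h r]; ext m; simp
  | succ n ih => intro r; rw [hb]; exact ih (h _)

lemma comp_inj (W : Submonoid R) [IsLocalization W Rw] (f : M →ₗ[R] Mw) [IsLocalizedModule W f]
    {n : ℕ} {δ : Mw →ₗ[A] N} (h : δ ∈ DiffLE A R Mw N n)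
    (h0 : δ.comp (f.restrictScalars A) = 0) : δ = 0 := by
  have hf : ∀ m, δ (f m) = 0 := fun m => LinearMap.congr_fun h0 m
  have main : ∀ δ : Mw →ₗ[A] N, (∀ r, opBracket A R Mw N r δ = 0) → (∀ m, δ (f m) = 0) →
      δ = 0 := by
    intro δ hl hf
    ext x
    obtain ⟨⟨m, w⟩, hx⟩ := IsLocalizedModule.surj W f x
    obtain ⟨c, hc⟩ := exists_inv W Rw w.2
    have h3 := LinearMap.congr_fun (hl w) x
    simp only [opBracket_apply, LinearMap.zero_apply] at h3
    have hx' : (w : R) • x = f m := hx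
    rw [hx', hf, zero_sub, neg_eq_zero] at h3
    rw [← one_smul Rw (δ x), ← hc, mul_smul, algebraMap_smul, h3, smul_zero]
    rfl
  clear h0
  induction n generalizing δ with
  | zero => exact main δ h hf
  | succ n ih =>
    refine main δ (fun r => ih (h r) fun m => ?_) hf
    rw [opBracket_apply, ← map_smul, hf, hf, smul_zero, sub_zero]

/-- `δ'` is the canonical extension of `δ` to the localized module. -/
def IsExt (W : Submonoid R) (f : M →ₗ[R] Mw) (n : ℕ) (δ : M →ₗ[A] N) (δ' : Mw →ₗ[A] N) : Prop :=
  ∀ w ∈ W, ∀ ε ∈ DiffLE A R M N n, preSMul A R M N w ε = δ →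
    ∀ (x : Mw) (m : M), w • x = f m → δ' x = ε m

lemma IsExt.mem (W : Submonoid R) [IsLocalization W Rw] (f : M →ₗ[R] Mw)
    [IsLocalizedModule W f] {n : ℕ} {δ : M →ₗ[A] N} {δ' : Mw →ₗ[A] N}
    (h : δ ∈ DiffLE A R M N n) (hE : IsExt W f n δ δ') : δ' ∈ DiffLE A R Mw N n := by
  have key : ∀ {n : ℕ} {δ : M →ₗ[A] N} {δ' : Mw →ₗ[A] N}, IsExt W f n δ δ' →
      ∀ w ∈ W, ∀ ε ∈ DiffLE A R M N n, preSMul A R M N w ε = δ →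
      ∀ (r : R) (x : Mw) (m : M), w • x = f m →
        opBracket A R Mw N r δ' x = opBracket A R M N r ε m := by
    intro n δ δ' hE w hw ε hε he r x m hx
    rw [opBracket_apply, opBracket_apply, hE w hw ε hε he x m hx,
      hE w hw ε hε he (r • x) (r • m) (by rw [smul_comm, hx, map_smul])]
  induction n generalizing δ δ' with
  | zero =>
    intro r
    ext x
    obtain ⟨⟨m, w⟩, hx⟩ := IsLocalizedModule.surj W f x
    obtain ⟨c, hc⟩ := exists_inv W Rw w.2
    obtain ⟨ε, hε, he⟩ := pre_surj hc h
    rw [key hE w w.2 ε hε he r x m hx, hε r]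
    rfl
  | succ n ih =>
    intro r
    refine ih (h r) ?_
    intro w hw η hη hηe x m hx
    obtain ⟨c, hc⟩ := exists_inv W Rw hw
    obtain ⟨ε, hε, he⟩ := pre_surj hc h
    rw [key hE w hw ε hε he r x m hx]
    rw [pre_inj hc (hε r) hη]
    rw [← opBracket_pre, he, hηe]

lemma exists_isExt (W : Submonoid R) [IsLocalization W Rw] (f : M →ₗ[R] Mw)
    [IsLocalizedModule W f] {n : ℕ} {δ : M →ₗ[A] N}
    (h : δ ∈ DiffLE A R M N n) : ∃ δ' : Mw →ₗ[A] N, IsExt W f n δ δ' := by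
  have wd : ∀ x : Mw, ∃ y : N, ∀ w ∈ W, ∀ ε ∈ DiffLE A R M N n, preSMul A R M N w ε = δ →
      ∀ m : M, w • x = f m → y = ε m := by
    intro x
    obtain ⟨⟨m, w⟩, hx⟩ := IsLocalizedModule.surj W f x
    obtain ⟨c, hc⟩ := exists_inv W Rw w.2
    obtain ⟨ε, hε, he⟩ := pre_surj hc h
    refine ⟨ε m, ?_⟩
    intro w' hw' ε' hε' he' m' hx'
    have hx1 : (w : R) • x = f m := hx
    have hff : f (w' • m) = f ((w : R) • m') := by
      rw [map_smul, map_smul, ← hx1, ← hx', smul_comm]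
    obtain ⟨u, hu⟩ := IsLocalizedModule.exists_of_eq (S := W) hff
    have hu' : (u : R) • w' • m = (u : R) • (w : R) • m' := hu
    obtain ⟨d, hd⟩ := exists_inv W Rw (W.mul_mem (W.mul_mem w.2 hw') u.2)
    obtain ⟨c', hc'⟩ := exists_inv W Rw hw'
    obtain ⟨θ, hθ, hθe⟩ := pre_surj hd h
    have hθe' : ∀ m, θ (((w : R) * w' * u) • m) = δ m := fun m => LinearMap.congr_fun hθe m
    have e1 : ε = preSMul A R M N (u * w') θ := by
      refine pre_inj hc hε (pre_mem_DiffLE _ hθ) ?_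
      rw [he]
      ext m
      rw [preSMul_apply, preSMul_apply, ← hθe' m, ← mul_smul]
      congr 2; ring
    have e2 : ε' = preSMul A R M N (u * w) θ := by
      refine pre_inj hc' hε' (pre_mem_DiffLE _ hθ) ?_
      rw [he']
      ext m
      rw [preSMul_apply, preSMul_apply, ← hθe' m, ← mul_smul]
      congr 2; ring
    rw [e1, e2, preSMul_apply, preSMul_apply, mul_smul, mul_smul, hu']
  choose g hg using wd
  refine ⟨{ toFun := g, map_add' := ?_, map_smul' := ?_ }, ?_⟩
  · intro x y
    obtain ⟨⟨m, w⟩, hx⟩ := IsLocalizedModule.surj W f x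
    obtain ⟨⟨m', w'⟩, hy⟩ := IsLocalizedModule.surj W f y
    have hx1 : (w : R) • x = f m := hx
    have hy1 : (w' : R) • y = f m' := hy
    have hmem := W.mul_mem w.2 w'.2
    obtain ⟨c, hc⟩ := exists_inv W Rw hmem
    obtain ⟨ε, hε, he⟩ := pre_surj hc h
    have hx2 : ((w : R) * w') • x = f ((w' : R) • m) := by
      rw [mul_comm, mul_smul, hx1, map_smul]
    have hy2 : ((w : R) * w') • y = f ((w : R) • m') := by
      rw [mul_smul, hy1, map_smul]
    rw [hg x _ hmem ε hε he _ hx2, hg y _ hmem ε hε he _ hy2, ← map_add]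
    exact hg _ _ hmem ε hε he _ (by rw [smul_add, hx2, hy2, map_add])
  · intro a x
    obtain ⟨⟨m, w⟩, hx⟩ := IsLocalizedModule.surj W f x
    have hx1 : (w : R) • x = f m := hx
    obtain ⟨c, hc⟩ := exists_inv W Rw w.2
    obtain ⟨ε, hε, he⟩ := pre_surj hc h
    rw [hg x _ w.2 ε hε he _ hx1, RingHom.id_apply, ← map_smul]
    refine hg _ _ w.2 ε hε he _ ?_
    rw [← algebraMap_smul R a x, ← algebraMap_smul R a m, smul_comm, hx1, map_smul]
  · intro w hw ε hε he x m hx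
    exact hg x w hw ε hε he m hx

lemma IsExt.comp_eq (W : Submonoid R) (f : M →ₗ[R] Mw)
    {n : ℕ} {δ : M →ₗ[A] N} {δ' : Mw →ₗ[A] N}
    (h : δ ∈ DiffLE A R M N n) (hE : IsExt W f n δ δ') :
    δ'.comp (f.restrictScalars A) = δ := by
  ext m
  exact hE 1 W.one_mem δ h (by ext m; simp) (f m) m (one_smul _ _)

lemma restrictScalars_mem_iff {Aw : Type*} [CommRing Aw] [Algebra A Aw]
    [Algebra Aw Rw] [Module Aw Mw] [IsScalarTower A Aw Mw] [IsScalarTower Aw Rw Mw]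
    [Module Aw N] [IsScalarTower A Aw N] [IsScalarTower Aw Rw N] {n : ℕ} (δ : Mw →ₗ[Aw] N) :
    (δ.restrictScalars A : Mw →ₗ[A] N) ∈ DiffLE A Rw Mw N n ↔ δ ∈ DiffLE Aw Rw Mw N n := by
  have hb : ∀ (r : Rw) (δ : Mw →ₗ[Aw] N),
      opBracket A Rw Mw N r (δ.restrictScalars A)
        = (opBracket Aw Rw Mw N r δ).restrictScalars A := fun r δ => rfl
  induction n generalizing δ with
  | zero =>
    refine forall_congr' fun r => ?_
    rw [hb]
    exact (LinearMap.restrictScalars_injective A).eq_iff' rfl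
  | succ n ih =>
    refine forall_congr' fun r => ?_
    rw [hb]
    exact ih _

end Loc

/-- **Differential operators into a localized module localize** (Lemma 2.8(iii)).  Let `R`
be a commutative ring, `A ⊆ R` a subring, `W ⊆ R` a multiplicatively closed set, `M` an
`R`-module and `N` a module over `W⁻¹R`.  Write `Rw = W⁻¹R`, `Aw = (W ∩ A)⁻¹A`,
`Mw = W⁻¹M` (with localization map `f : M → Mw`).  Then restriction along `f` is an
`R`-module isomorphism `Diffⁿ_{Rw/A}(Mw, N) ≅ Diffⁿ_{R/A}(M, N)`, and restriction of
scalars is an `R`-module isomorphism `Diffⁿ_{Rw/Aw}(Mw, N) ≅ Diffⁿ_{Rw/A}(Mw, N)`. -/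
theorem diffLE_localization
    (A R : Type*) [CommRing A] [CommRing R] [Algebra A R]
    (hAR : Function.Injective (algebraMap A R))
    (W : Submonoid R)
    (M N : Type*) [AddCommGroup M] [Module R M] [Module A M] [IsScalarTower A R M]
    [AddCommGroup N] [Module R N] [Module A N] [IsScalarTower A R N]
    (Rw : Type*) [CommRing Rw] [Algebra R Rw] [IsLocalization W Rw]
    [Algebra A Rw] [IsScalarTower A R Rw]
    (Aw : Type*) [CommRing Aw] [Algebra A Aw]
    [IsLocalization (W.comap (algebraMap A R)) Aw]
    [Algebra Aw Rw] [IsScalarTower A Aw Rw]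
    (Mw : Type*) [AddCommGroup Mw] [Module R Mw] [Module Rw Mw] [IsScalarTower R Rw Mw]
    [Module A Mw] [IsScalarTower A R Mw] [IsScalarTower A Rw Mw] [Module Aw Mw]
    [IsScalarTower A Aw Mw] [IsScalarTower Aw Rw Mw]
    (f : M →ₗ[R] Mw) [IsLocalizedModule W f]
    [Module Rw N] [IsScalarTower R Rw N] [IsScalarTower A Rw N] [Module Aw N]
    [IsScalarTower A Aw N] [IsScalarTower Aw Rw N]
    (n : ℕ) :
    (Set.BijOn (fun δ : Mw →ₗ[A] N => δ.comp (f.restrictScalars A))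
      (DiffLE A Rw Mw N n) (DiffLE A R M N n)) ∧
    (∀ (δ ε : Mw →ₗ[A] N),
      (δ + ε).comp (f.restrictScalars A)
        = δ.comp (f.restrictScalars A) + ε.comp (f.restrictScalars A)) ∧
    (∀ (r : R) (δ : Mw →ₗ[A] N),
      (algebraMap R Rw r • δ).comp (f.restrictScalars A)
        = r • δ.comp (f.restrictScalars A)) ∧
    (Set.BijOn (fun δ : Mw →ₗ[Aw] N => (δ.restrictScalars A : Mw →ₗ[A] N))
      (DiffLE Aw Rw Mw N n) (DiffLE A Rw Mw N n)) ∧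
    (∀ (δ ε : Mw →ₗ[Aw] N),
      ((δ + ε).restrictScalars A : Mw →ₗ[A] N)
        = δ.restrictScalars A + ε.restrictScalars A) ∧
    (∀ (r : Rw) (δ : Mw →ₗ[Aw] N),
      ((r • δ).restrictScalars A : Mw →ₗ[A] N) = r • δ.restrictScalars A) := by
  refine ⟨⟨?_, ?_, ?_⟩, ?_, ?_, ⟨?_, ?_, ?_⟩, ?_, ?_⟩
  · intro δ hδ
    exact comp_mem f (DiffLE_of_Rw hδ)
  · intro δ hδ ε hε he
    have he' : δ.comp (f.restrictScalars A) = ε.comp (f.restrictScalars A) := he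
    rw [← sub_eq_zero]
    refine comp_inj (Rw := Rw) W f (sub_mem_DiffLE (DiffLE_of_Rw hδ) (DiffLE_of_Rw hε)) ?_
    rw [LinearMap.sub_comp, he', sub_self]
  · intro δ hδ
    obtain ⟨δ', hE⟩ := exists_isExt (Rw := Rw) W f hδ
    exact ⟨δ', DiffLE_to_Rw W (hE.mem (Rw := Rw) W f hδ), hE.comp_eq W f hδ⟩
  · intro δ ε; rfl
  · intro r δ
    ext m
    simp [algebraMap_smul]
  · intro δ hδ
    exact (restrictScalars_mem_iff δ).2 hδ
  · intro δ _ ε _ he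
    exact LinearMap.restrictScalars_injective A he
  · intro δ hδ
    have hr : ((δ.extendScalarsOfIsLocalization (W.comap (algebraMap A R)) Aw).restrictScalars A :
      Mw →ₗ[A] N) = δ := by ext m; rfl
    refine ⟨δ.extendScalarsOfIsLocalization (W.comap (algebraMap A R)) Aw, ?_, hr⟩
    rw [← restrictScalars_mem_iff (A := A), hr]
    exact hδ
  · intro δ ε; rfl
  · intro r δ; rfl

end NoetherianOps
end

section
/- Let R be a commutative ring, A a subring of R, M, N two R-modules, and E ⊆ Diff^n_{R/A}(M, N) a nonzero (R ⊗_A R)-submodule. Then (a) E ∩ Hom_R(M, N) ≠ 0, and (b) Sol(E) = {m ∈ M | δ(m) = 0 for all δ ∈ E} is an R-submodule of M and Sol(E) ⊊ M. -/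
set_option linter.unusedSectionVars false

open scoped TensorProduct

namespace NoetherianOps

/-- An element of order at most `k` in `E` that is nonzero yields a nonzero `R`-linear one. -/
theorem exists_linear_of_diffLE
    (A R : Type*) [CommRing A] [CommRing R] [Algebra A R]
    (M N : Type*) [AddCommGroup M] [Module R M] [Module A M] [IsScalarTower A R M]
    [AddCommGroup N] [Module R N] [Module A N] [IsScalarTower A R N]
    (E : Set (M →ₗ[A] N)) (hb : ∀ r : R, ∀ δ ∈ E, opBracket A R M N r δ ∈ E) (k : ℕ) :
    ∀ δ ∈ E, δ ≠ 0 → δ ∈ DiffLE A R M N k →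
      ∃ ε ∈ E, ε ≠ 0 ∧ ε ∈ DiffLE A R M N 0 := by
  induction k with
  | zero => exact fun δ h1 h2 h3 => ⟨δ, h1, h2, h3⟩
  | succ k ih =>
    intro δ h1 h2 h3
    by_cases h : ∀ r : R, opBracket A R M N r δ = 0
    · exact ⟨δ, h1, h2, h⟩
    · obtain ⟨r, hr⟩ := not_forall.mp h
      exact ih _ (hb r δ h1) hr (h3 r)

/-- **Basic properties of solution sets of `(R ⊗[A] R)`-submodules of differential
operators** (Proposition 3.5(i),(ii)).  If `E ⊆ Diffⁿ_{R/A}(M, N)` is a nonzero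
`(R ⊗[A] R)`-submodule, then (a) `E` contains a nonzero `R`-linear map (an element of
`Diff⁰_{R/A}(M, N) = Hom_R(M, N)`), and (b) `Sol(E)` is a proper `R`-submodule of `M`. -/
theorem sol_isSubmodule_of_tensorSubmodule
    (A R : Type*) [CommRing A] [CommRing R] [Algebra A R]
    (hAR : Function.Injective (algebraMap A R))
    (M N : Type*) [AddCommGroup M] [Module R M] [Module A M] [IsScalarTower A R M]
    [AddCommGroup N] [Module R N] [Module A N] [IsScalarTower A R N]
    (n : ℕ) (E : Set (M →ₗ[A] N))
    (hE : E ⊆ DiffLE A R M N n) (hEsub : IsTensorSubmodule A R M N E)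
    (hEne : ∃ δ ∈ E, δ ≠ 0) :
    (∃ δ ∈ E, δ ≠ 0 ∧ δ ∈ DiffLE A R M N 0) ∧
    (∃ U : Submodule R M, (U : Set M) = Sol E) ∧
    Sol E ≠ Set.univ := by
  obtain ⟨h0, hadd, hneg, hsmul, hpre⟩ := hEsub
  obtain ⟨δ, hδ, hne⟩ := hEne
  refine ⟨?_, ⟨{ carrier := Sol E, add_mem' := ?_, zero_mem' := ?_, smul_mem' := ?_ }, rfl⟩, ?_⟩
  · refine exists_linear_of_diffLE A R M N E ?_ n δ hδ hne (hE hδ)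
    intro r ε hε
    have h := hadd _ (hpre r ε hε) _ (hneg _ (hsmul r ε hε))
    rwa [← sub_eq_add_neg] at h
  · intro a b ha hb ε hε
    rw [map_add, ha ε hε, hb ε hε, add_zero]
  · intro ε _
    exact map_zero ε
  · intro r m hm ε hε
    exact hm _ (hpre r ε hε)
  · intro h
    apply hne
    ext m
    have hm : m ∈ Sol E := h ▸ Set.mem_univ m
    exact hm δ hδ

end NoetherianOps
end

section
/- Let R be a commutative ring, A a subring of R, p a prime ideal of R, M an R-module, and N an R-module which is a torsion-free module over R/p. Let E ⊆ Diff^n_{R/A}(M, N) be an (R ⊗_A R)-submodule and Sol(E) = {m ∈ M | δ(m) = 0 for all δ ∈ E}. Then p^{n+1}M ⊆ Sol(E), and for all r ∈ R and m ∈ M, if rm ∈ Sol(E) and m ∉ Sol(E) then r ∈ p; in particular, if E ≠ 0 then Sol(E) is a p-primary R-submodule of M. -/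
set_option linter.unusedSectionVars false

open scoped TensorProduct

namespace NoetherianOps

lemma diffLE_apply_eq_zero
    (A R : Type*) [CommRing A] [CommRing R] [Algebra A R] (p : Ideal R)
    (M N : Type*) [AddCommGroup M] [Module R M] [Module A M] [IsScalarTower A R M]
    [AddCommGroup N] [Module R N] [Module A N] [IsScalarTower A R N]
    (hNmod : ∀ r ∈ p, ∀ x : N, r • x = 0) (n : ℕ) :
    ∀ δ ∈ DiffLE A R M N n, ∀ m ∈ (p ^ (n + 1)) • (⊤ : Submodule R M), δ m = 0 := by
  induction n with
  | zero =>
    intro δ hδ m hm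
    refine Submodule.smul_induction_on hm ?_ ?_
    · intro r hr x _
      have h := LinearMap.congr_fun (hδ r) x
      rw [opBracket_apply, hNmod r (by simpa using hr), sub_zero] at h
      simpa using h
    · intro x y hx hy
      rw [map_add, hx, hy, add_zero]
  | succ n ih =>
    intro δ hδ m hm
    rw [pow_succ', mul_smul] at hm
    refine Submodule.smul_induction_on hm ?_ ?_
    · intro r hr x hx
      have h := ih _ (hδ r) x hx
      rwa [opBracket_apply, hNmod r hr, sub_zero] at h
    · intro x y hx hy
      rw [map_add, hx, hy, add_zero]

lemma tensorSubmodule_apply_eq_zero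
    (A R : Type*) [CommRing A] [CommRing R] [Algebra A R] (p : Ideal R)
    (M N : Type*) [AddCommGroup M] [Module R M] [Module A M] [IsScalarTower A R M]
    [AddCommGroup N] [Module R N] [Module A N] [IsScalarTower A R N]
    (hNtf : ∀ r : R, r ∉ p → ∀ x : N, r • x = 0 → x = 0)
    (E : Set (M →ₗ[A] N)) (hEsub : IsTensorSubmodule A R M N E)
    (r : R) (hr : r ∉ p) (m : M) (hm : r • m ∈ Sol E) (n : ℕ) :
    ∀ δ ∈ E, δ ∈ DiffLE A R M N n → δ m = 0 := by
  have key : ∀ δ ∈ E, opBracket A R M N r δ m = 0 → δ m = 0 := by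
    intro δ hδE h
    rw [opBracket_apply, hm δ hδE, zero_sub, neg_eq_zero] at h
    exact hNtf r hr _ h
  induction n with
  | zero =>
    intro δ hδE hδ
    apply key δ hδE
    rw [hδ r]; rfl
  | succ n ih =>
    intro δ hδE hδ
    apply key δ hδE
    refine ih _ ?_ (hδ r)
    obtain ⟨_, h1, h2, h3, h4⟩ := hEsub
    unfold opBracket
    rw [sub_eq_add_neg]
    exact h1 _ (h4 r δ hδE) _ (h2 _ (h3 r δ hδE))

lemma associatedPrimes_eq_singleton_of_pow
    {R Q : Type*} [CommRing R] [AddCommGroup Q] [Module R Q] [Nontrivial Q]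
    (p : Ideal R) [hp : p.IsPrime] (k : ℕ)
    (h1 : ∀ q ∈ (p ^ k) • (⊤ : Submodule R Q), q = 0)
    (h2 : ∀ (r : R) (q : Q), r • q = 0 → q ≠ 0 → r ∈ p) :
    associatedPrimes R Q = {p} := by
  classical
  have hkill : ∀ r ∈ p, ∀ q : Q, r ^ k • q = 0 := fun r hr q =>
    h1 _ (Submodule.smul_mem_smul (Ideal.pow_mem_pow hr k) trivial)
  ext I
  rw [Set.mem_singleton_iff]
  constructor
  · rintro ⟨hI, x, hx⟩
    have hmem : ∀ r : R, r ∈ I ↔ ∃ j : ℕ, r ^ j • x = 0 := by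
      intro r
      rw [hx, Ideal.mem_radical_iff]
      simp [Submodule.mem_colon_singleton]
    have hx0 : x ≠ 0 := by
      intro h0
      exact hI.ne_top ((Ideal.eq_top_iff_one I).2 ((hmem 1).2 ⟨0, by simp [h0]⟩))
    apply le_antisymm
    · intro r hr
      obtain ⟨j, hj⟩ := (hmem r).1 hr
      exact hp.mem_of_pow_mem j (h2 _ _ hj hx0)
    · intro r hr
      exact (hmem r).2 ⟨k, hkill r hr x⟩
  · rintro rfl
    have hex : ∃ j, ∀ q ∈ (I ^ j) • (⊤ : Submodule R Q), q = 0 := ⟨k, h1⟩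
    obtain ⟨q, hq, hq0, hann⟩ : ∃ q : Q, True ∧ q ≠ 0 ∧ ∀ r ∈ I, r • q = 0 := by
      have hs := Nat.find_spec hex
      rcases hj : Nat.find hex with _ | j
      · rw [hj] at hs
        obtain ⟨q, hq⟩ := exists_ne (0 : Q)
        exact absurd (hs q (by simp)) hq
      · have hm := Nat.find_min hex (m := j) (by omega)
        push Not at hm
        obtain ⟨q, hq, hq0⟩ := hm
        refine ⟨q, trivial, hq0, fun r hr => ?_⟩
        rw [hj] at hs
        apply hs
        rw [pow_succ', mul_smul]
        exact Submodule.smul_mem_smul hr hq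
    refine ⟨hp, q, ?_⟩
    ext r
    rw [Ideal.mem_radical_iff]
    simp only [Submodule.mem_colon_singleton, Submodule.mem_bot]
    constructor
    · intro hr
      exact ⟨1, by rw [pow_one]; exact hann r hr⟩
    · rintro ⟨j, hj⟩
      exact hp.mem_of_pow_mem j (h2 _ _ hj hq0)

/-- **Solution sets are `p`-primary submodules** (Proposition 3.5(iii)).  Let `p` be a prime
of `R` and `N` an `R`-module which is a torsion-free module over `R/p`.  If
`E ⊆ Diffⁿ_{R/A}(M, N)` is an `(R ⊗[A] R)`-submodule, then `p^{n+1}M ⊆ Sol(E)`, and for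
`r ∈ R`, `m ∈ M`, `r • m ∈ Sol(E)` and `m ∉ Sol(E)` imply `r ∈ p`; in particular, if
`E ≠ 0` then `Sol(E)` is a `p`-primary submodule of `M` (a proper submodule with
`Ass(M/Sol(E)) = {p}`). -/
theorem sol_isPrimary_of_tensorSubmodule
    (A R : Type*) [CommRing A] [CommRing R] [Algebra A R]
    (hAR : Function.Injective (algebraMap A R))
    (p : Ideal R) [p.IsPrime]
    (M N : Type*) [AddCommGroup M] [Module R M] [Module A M] [IsScalarTower A R M]
    [AddCommGroup N] [Module R N] [Module A N] [IsScalarTower A R N]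
    (hNmod : ∀ r ∈ p, ∀ x : N, r • x = 0)
    (hNtf : ∀ r : R, r ∉ p → ∀ x : N, r • x = 0 → x = 0)
    (n : ℕ) (E : Set (M →ₗ[A] N))
    (hE : E ⊆ DiffLE A R M N n) (hEsub : IsTensorSubmodule A R M N E) :
    (∀ m ∈ (p ^ (n + 1)) • (⊤ : Submodule R M), m ∈ Sol E) ∧
    (∀ (r : R) (m : M), r • m ∈ Sol E → m ∉ Sol E → r ∈ p) ∧
    ((∃ δ ∈ E, δ ≠ 0) →
      ∃ U : Submodule R M, (U : Set M) = Sol E ∧ U ≠ ⊤ ∧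
        associatedPrimes R (M ⧸ U) = {p}) := by
  have hP1 : ∀ m ∈ (p ^ (n + 1)) • (⊤ : Submodule R M), m ∈ Sol E := fun m hm δ hδ =>
    diffLE_apply_eq_zero A R p M N hNmod n δ (hE hδ) m hm
  have hP2 : ∀ (r : R) (m : M), r • m ∈ Sol E → m ∉ Sol E → r ∈ p := by
    intro r m hrm hm
    by_contra hr
    exact hm fun δ hδ =>
      tensorSubmodule_apply_eq_zero A R p M N hNtf E hEsub r hr m hrm n δ hδ (hE hδ)
  refine ⟨hP1, hP2, ?_⟩
  rintro ⟨δ, hδE, hδ0⟩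
  let U : Submodule R M :=
    { carrier := Sol E
      zero_mem' := fun δ _ => map_zero δ
      add_mem' := fun {x y} hx hy δ hδ => by rw [map_add, hx δ hδ, hy δ hδ, add_zero]
      smul_mem' := fun r x hx δ hδ => hx _ (hEsub.2.2.2.2 r δ hδ) }
  have hU : U ≠ ⊤ := by
    intro h
    apply hδ0
    ext m
    have hm : m ∈ U := h ▸ Submodule.mem_top
    exact hm δ hδE
  refine ⟨U, rfl, hU, ?_⟩
  have : Nontrivial (M ⧸ U) := Submodule.Quotient.nontrivial_iff.2 hU
  refine associatedPrimes_eq_singleton_of_pow p (n + 1) ?_ ?_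
  · intro q hq
    refine Submodule.smul_induction_on hq ?_ ?_
    · intro r hr x _
      obtain ⟨m, rfl⟩ := Submodule.Quotient.mk_surjective U x
      rw [← Submodule.Quotient.mk_smul, Submodule.Quotient.mk_eq_zero]
      exact hP1 _ (Submodule.smul_mem_smul hr trivial)
    · intro x y hx hy
      rw [hx, hy, add_zero]
  · intro r q hrq hq
    obtain ⟨m, rfl⟩ := Submodule.Quotient.mk_surjective U q
    rw [← Submodule.Quotient.mk_smul, Submodule.Quotient.mk_eq_zero] at hrq
    rw [Ne, Submodule.Quotient.mk_eq_zero] at hq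
    exact hP2 r m hrq hq


end NoetherianOps
end

section
/- Let K be a field, S an Artinian local K-algebra, T a commutative K-algebra, and M an S-module. Then for every prime ideal Q of T ⊗_K S, the canonical map M → (T ⊗_K M)_Q sending m to (1 ⊗ m)/1 is injective, where (T ⊗_K M)_Q denotes the localization of the (T ⊗_K S)-module T ⊗_K M at the prime Q. -/
set_option linter.unusedSectionVars false

open scoped TensorProduct

namespace NoetherianOps

section Bimodule

variable (K T S M : Type*) [CommRing K] [CommRing T] [CommRing S]
  [Algebra K T] [Algebra K S]
  [AddCommGroup M] [Module K M] [Module S M] [IsScalarTower K S M]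

/-- The action of `S` on `T ⊗[K] M` through the right factor: `s • (t ⊗ m) = t ⊗ (s • m)`. -/
noncomputable def tensorRightModule : Module S (T ⊗[K] M) where
  smul s := LinearMap.lTensor T (s • (LinearMap.id : M →ₗ[K] M))
  one_smul x := by
    show LinearMap.lTensor T ((1 : S) • (LinearMap.id : M →ₗ[K] M)) x = x
    rw [one_smul, LinearMap.lTensor_id, LinearMap.id_apply]
  mul_smul s t x := by
    show LinearMap.lTensor T ((s * t) • (LinearMap.id : M →ₗ[K] M)) x = _
    have : (s * t) • (LinearMap.id : M →ₗ[K] M)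
        = (s • (LinearMap.id : M →ₗ[K] M)).comp (t • (LinearMap.id : M →ₗ[K] M)) := by
      ext m; simp [mul_smul]
    rw [this, LinearMap.lTensor_comp, LinearMap.comp_apply]
    rfl
  smul_zero s := by
    show LinearMap.lTensor T (s • (LinearMap.id : M →ₗ[K] M)) 0 = 0
    rw [map_zero]
  smul_add s x y := by
    show LinearMap.lTensor T (s • (LinearMap.id : M →ₗ[K] M)) (x + y) = _
    rw [map_add]; rfl
  add_smul s t x := by
    show LinearMap.lTensor T ((s + t) • (LinearMap.id : M →ₗ[K] M)) x = _
    rw [add_smul, LinearMap.lTensor_add, LinearMap.add_apply]; rfl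
  zero_smul x := by
    show LinearMap.lTensor T ((0 : S) • (LinearMap.id : M →ₗ[K] M)) x = 0
    rw [zero_smul, LinearMap.lTensor_zero, LinearMap.zero_apply]

/-- The canonical `(T ⊗[K] S)`-module structure on `T ⊗[K] M`, for `M` an `S`-module:
`(t ⊗ s) • (t' ⊗ m) = (t * t') ⊗ (s • m)`. -/
noncomputable def tensorBimodule : Module (T ⊗[K] S) (T ⊗[K] M) := by
  letI : Module S (T ⊗[K] M) := tensorRightModule K T S M
  haveI htower : IsScalarTower K S (T ⊗[K] M) := by
    constructor
    intro k s x
    show LinearMap.lTensor T ((k • s) • (LinearMap.id : M →ₗ[K] M)) x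
      = k • LinearMap.lTensor T (s • (LinearMap.id : M →ₗ[K] M)) x
    rw [smul_assoc, LinearMap.lTensor_smul, LinearMap.smul_apply]
  haveI hcomm : SMulCommClass T S (T ⊗[K] M) := by
    constructor
    intro t s x
    show t • LinearMap.lTensor T (s • (LinearMap.id : M →ₗ[K] M)) x
      = LinearMap.lTensor T (s • (LinearMap.id : M →ₗ[K] M)) (t • x)
    induction x using TensorProduct.induction_on with
    | zero => simp
    | tmul t' m =>
      simp [TensorProduct.smul_tmul', LinearMap.lTensor_tmul]
    | add x y hx hy => simp only [smul_add, map_add, hx, hy]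
  exact TensorProduct.Algebra.module

end Bimodule

/-- **Injectivity of the map to the localized tensor product** (Lemma 3.7).  Let `K` be a
field, `S` an Artinian local `K`-algebra, `T` a commutative `K`-algebra and `M` an
`S`-module.  For every prime ideal `Q` of `T ⊗[K] S`, the canonical map
`M → (T ⊗[K] M)_Q`, `m ↦ (1 ⊗ m)/1`, is injective, where `T ⊗[K] M` carries its canonical
`(T ⊗[K] S)`-module structure `(t ⊗ s) • (t' ⊗ m) = (t t') ⊗ (s m)`. -/
theorem injective_localized_tensor
    (K S T M : Type*) [Field K] [CommRing S] [CommRing T]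
    [Algebra K S] [Algebra K T] [IsArtinianRing S] [IsLocalRing S]
    [AddCommGroup M] [Module K M] [Module S M] [IsScalarTower K S M]
    (Q : Ideal (T ⊗[K] S)) [Q.IsPrime] :
    letI : Module (T ⊗[K] S) (T ⊗[K] M) := tensorBimodule K T S M
    Function.Injective (fun m : M =>
      (LocalizedModule.mk ((1 : T) ⊗ₜ[K] m) (1 : Q.primeCompl) :
        LocalizedModule Q.primeCompl (T ⊗[K] M))) := by
  letI : Module (T ⊗[K] S) (T ⊗[K] M) := tensorBimodule K T S M
  intro m m' h
  by_contra hne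
  obtain ⟨u, hu⟩ := LocalizedModule.mk_eq.mp h
  have hu' : (u : T ⊗[K] S) • ((1 : T) ⊗ₜ[K] m) = (u : T ⊗[K] S) • ((1 : T) ⊗ₜ[K] m') := by
    have h1 := hu
    simp only [one_smul] at h1
    exact h1
  let f : S →ₗ[K] M := (LinearMap.toSpanSingleton S M (m - m')).restrictScalars K
  have key : ∀ v : T ⊗[K] S,
      LinearMap.lTensor T f v = v • ((1 : T) ⊗ₜ[K] m) - v • ((1 : T) ⊗ₜ[K] m') := by
    have hsm : ∀ (t : T) (s : S) (n : M),
        (t ⊗ₜ[K] s : T ⊗[K] S) • ((1 : T) ⊗ₜ[K] n) = t ⊗ₜ[K] (s • n) := by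
      intro t s n
      have : (t ⊗ₜ[K] s : T ⊗[K] S) • ((1 : T) ⊗ₜ[K] n)
          = t • (LinearMap.lTensor T (s • (LinearMap.id : M →ₗ[K] M)) ((1 : T) ⊗ₜ[K] n)) := rfl
      rw [this]
      simp [TensorProduct.smul_tmul']
    intro v
    induction v using TensorProduct.induction_on with
    | zero => simp
    | tmul t s =>
      rw [hsm, hsm, LinearMap.lTensor_tmul, ← TensorProduct.tmul_sub, ← smul_sub]
      rfl
    | add x y hx hy => rw [map_add, hx, hy, add_smul, add_smul]; abel
  have h0 : LinearMap.lTensor T f (u : T ⊗[K] S) = 0 := by rw [key, hu', sub_self]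
  have hex := Module.Flat.lTensor_exact T (LinearMap.exact_subtype_ker_map f)
  obtain ⟨y, hy⟩ := (hex _).mp h0
  apply u.2
  rw [← hy]
  clear hy
  induction y using TensorProduct.induction_on with
  | zero => simp
  | add x y hx hy => rw [map_add]; exact Q.add_mem hx hy
  | tmul t s =>
    obtain ⟨s, hs⟩ := s
    have hs0 : s • (m - m') = 0 := hs
    have hsn : ¬ IsUnit s := by
      intro hun
      exact hne (sub_eq_zero.mp ((hun.smul_eq_zero).mp hs0))
    have hnil : IsNilpotent s := by
      obtain ⟨n, hn⟩ := IsArtinianRing.isNilpotent_jacobson_bot (R := S)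
      refine ⟨n, ?_⟩
      have hmem : s ∈ (⊥ : Ideal S).jacobson := by
        rw [IsLocalRing.jacobson_eq_maximalIdeal _ bot_ne_top]
        exact hsn
      have := Ideal.pow_mem_pow hmem n
      rw [hn] at this
      simpa using this
    obtain ⟨n, hn⟩ := hnil
    rw [LinearMap.lTensor_tmul]
    have : (t ⊗ₜ[K] s : T ⊗[K] S) ^ n = 0 := by
      rw [Algebra.TensorProduct.tmul_pow, hn, TensorProduct.tmul_zero]
    exact Ideal.IsPrime.mem_of_pow_mem inferInstance n (this ▸ Q.zero_mem)

end NoetherianOps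
end

section
/- Let R be a Noetherian commutative ring, p a prime ideal of R, and K ⊆ R_p a subfield such that the induced field extension K ↪ k(p) = R_p/pR_p is separable algebraic. Let M ⊆ k(p) ⊗_K R_p be the kernel of the canonical ring map k(p) ⊗_K R_p → k(p), k ⊗ r ↦ k·(r mod pR_p). Then the canonical map R_p → k(p) ⊗_K R_p, r ↦ 1 ⊗ r, induces: (i) an isomorphism of associated graded rings ⊕_{n≥0} p^n R_p / p^{n+1} R_p ≅ ⊕_{n≥0} M^n / M^{n+1}; and (ii) for every n ≥ 1, an isomorphism R_p / p^n R_p ≅ (k(p) ⊗_K R_p) / M^n. -/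
set_option linter.unusedSectionVars false

open scoped TensorProduct

namespace NoetherianOps

/-- **Associated graded rings of `pR_p` and of the diagonal maximal ideal agree**
(Proposition 3.9).  Let `R` be a Noetherian ring, `p` a prime of `R`, `Rp = R_p`, and
`K ⊆ R_p` a subfield such that `K ↪ k(p) = R_p/pR_p` is separable algebraic.  Let
`M ⊆ k(p) ⊗[K] R_p` be the kernel of the canonical map `k(p) ⊗[K] R_p → k(p)` and let
`φ : R_p → k(p) ⊗[K] R_p`, `r ↦ 1 ⊗ r`, be the canonical map.  Then `φ` induces
(i) an isomorphism of associated graded rings `⊕ pⁿR_p/p^{n+1}R_p ≅ ⊕ Mⁿ/M^{n+1}`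
(expressed degreewise: `φ` maps `pⁿR_p` into `Mⁿ`, is surjective onto `Mⁿ` modulo
`M^{n+1}`, and is injective on `pⁿR_p` modulo `p^{n+1}R_p`); and
(ii) for every `n ≥ 1` an isomorphism `R_p/pⁿR_p ≅ (k(p) ⊗[K] R_p)/Mⁿ`
(expressed as: `φ` is surjective modulo `Mⁿ` and `φ⁻¹(Mⁿ) = pⁿR_p`). -/
theorem associatedGraded_iso_of_separable
    (R : Type*) [CommRing R] [IsNoetherianRing R]
    (p : Ideal R) [p.IsPrime]
    (Rp : Type*) [CommRing Rp] [Algebra R Rp] [IsLocalization.AtPrime Rp p]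
    (K : Type*) [Field K] [Algebra K Rp]
    (kp : Type*) [Field kp] [Algebra Rp kp]
    (hsurj : Function.Surjective (algebraMap Rp kp))
    (hker : RingHom.ker (algebraMap Rp kp) = p.map (algebraMap R Rp))
    [Algebra K kp] [IsScalarTower K Rp kp]
    [Algebra.IsSeparable K kp] :
    let φ : Rp →ₐ[K] kp ⊗[K] Rp := Algebra.TensorProduct.includeRight
    let MM : Ideal (kp ⊗[K] Rp) :=
      RingHom.ker (Algebra.TensorProduct.productMap (AlgHom.id K kp)
        (IsScalarTower.toAlgHom K Rp kp))
    let pRp : Ideal Rp := p.map (algebraMap R Rp)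
    (∀ n : ℕ,
      (∀ x ∈ pRp ^ n, φ x ∈ MM ^ n) ∧
      (∀ z ∈ MM ^ n, ∃ x ∈ pRp ^ n, z - φ x ∈ MM ^ (n + 1)) ∧
      (∀ x ∈ pRp ^ n, φ x ∈ MM ^ (n + 1) → x ∈ pRp ^ (n + 1))) ∧
    (∀ n : ℕ, 1 ≤ n →
      (∀ z : kp ⊗[K] Rp, ∃ x : Rp, z - φ x ∈ MM ^ n) ∧
      (∀ x : Rp, φ x ∈ MM ^ n ↔ x ∈ pRp ^ n)) := by
  intro φ MM pRp
  have hφa : ∀ x, φ x = 1 ⊗ₜ[K] x := fun x => rfl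
  have hmem : ∀ z, z ∈ MM ↔ Algebra.TensorProduct.productMap (AlgHom.id K kp)
        (IsScalarTower.toAlgHom K Rp kp) z = 0 := fun z => RingHom.mem_ker
  have hpm : ∀ x, φ x ∈ MM ↔ x ∈ pRp := by
    intro x
    rw [hmem, hφa]
    show _ ↔ x ∈ p.map (algebraMap R Rp)
    rw [← hker, RingHom.mem_ker]
    simp
  have hmaple : pRp.map φ ≤ MM := by
    rw [Ideal.map_le_iff_le_comap]
    intro x hx
    exact (hpm x).2 hx
  have hpow : ∀ n : ℕ, ∀ x ∈ pRp ^ n, φ x ∈ MM ^ n := by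
    intro n x hx
    have h := Ideal.mem_map_of_mem φ hx
    rw [Ideal.map_pow] at h
    exact Ideal.pow_right_mono hmaple n h
  -- injectivity, by formal smoothness
  have hinj : ∀ n : ℕ, ∀ x, φ x ∈ MM ^ n → x ∈ pRp ^ n := by
    intro n x hx
    rcases Nat.eq_zero_or_pos n with rfl | hn
    · simp
    have hle : ∀ a ∈ pRp ^ n, IsScalarTower.toAlgHom K Rp kp a = 0 := by
      intro a ha
      have : a ∈ RingHom.ker (algebraMap Rp kp) := by
        rw [hker]; exact Ideal.pow_le_self (by omega) ha
      exact this
    let g : (Rp ⧸ pRp ^ n) →ₐ[K] kp := Ideal.Quotient.liftₐ (pRp ^ n)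
      (IsScalarTower.toAlgHom K Rp kp) hle
    have hgmk : ∀ a, g (Ideal.Quotient.mk _ a) = algebraMap Rp kp a := fun a => rfl
    have hg : Function.Surjective g := by
      intro y
      obtain ⟨a, rfl⟩ := hsurj y
      exact ⟨Ideal.Quotient.mk _ a, rfl⟩
    have hkerg : RingHom.ker g ≤ pRp.map (Ideal.Quotient.mk (pRp ^ n)) := by
      intro y hy
      obtain ⟨a, rfl⟩ := Ideal.Quotient.mk_surjective y
      rw [RingHom.mem_ker, hgmk, ← RingHom.mem_ker, hker] at hy
      exact Ideal.mem_map_of_mem _ hy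
    have hbot : (pRp.map (Ideal.Quotient.mk (pRp ^ n))) ^ n = ⊥ := by
      exact (Ideal.map_pow _ pRp n).symm.trans (Ideal.map_quotient_self _)
    have hnil : IsNilpotent (RingHom.ker (g : (Rp ⧸ pRp ^ n) →+* kp)) := by
      refine ⟨n, ?_⟩
      rw [Ideal.zero_eq_bot, eq_bot_iff, ← hbot]
      exact Ideal.pow_right_mono hkerg n
    have : Algebra.FormallyEtale K kp := Algebra.FormallyEtale.of_isSeparable K kp
    let s : kp →ₐ[K] (Rp ⧸ pRp ^ n) :=
      Algebra.FormallySmooth.liftOfSurjective (AlgHom.id K kp) g hg hnil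
    have hs : ∀ y, g (s y) = y := fun y =>
      Algebra.FormallySmooth.liftOfSurjective_apply (AlgHom.id K kp) g hg hnil y
    let ψ : kp ⊗[K] Rp →ₐ[K] (Rp ⧸ pRp ^ n) :=
      Algebra.TensorProduct.productMap s (Ideal.Quotient.mkₐ K (pRp ^ n))
    have hgψ : g.comp ψ = Algebra.TensorProduct.productMap (AlgHom.id K kp)
        (IsScalarTower.toAlgHom K Rp kp) := by
      apply Algebra.TensorProduct.ext'
      intro a b
      simp [ψ, hs, hgmk]
    have hψM : MM.map ψ ≤ RingHom.ker g := by
      rw [Ideal.map_le_iff_le_comap]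
      intro z hz
      rw [hmem, ← hgψ] at hz
      exact hz
    have h0 : ψ (φ x) ∈ (⊥ : Ideal (Rp ⧸ pRp ^ n)) := by
      rw [← hbot]
      refine Ideal.pow_right_mono (hψM.trans hkerg) n ?_
      exact (Ideal.map_pow ψ MM n).le (Ideal.mem_map_of_mem ψ hx)
    have h1 : ψ (φ x) = Ideal.Quotient.mk (pRp ^ n) x := by
      rw [hφa]; simp [ψ]
    rw [h1, Ideal.mem_bot, Ideal.Quotient.eq_zero_iff_mem] at h0
    exact h0
  -- surjectivity, by formal unramifiedness
  have hM : MM ≤ pRp.map φ ⊔ MM ^ 2 := by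
    have : Algebra.FormallyEtale K kp := Algebra.FormallyEtale.of_isSeparable K kp
    have hJ : IsIdempotentElem (KaehlerDifferential.ideal K kp) := by
      rw [← Ideal.cotangent_subsingleton_iff]
      exact (inferInstance : Subsingleton (Ω[kp⁄K]))
    let q : kp ⊗[K] Rp →ₐ[K] kp ⊗[K] kp :=
      Algebra.TensorProduct.map (AlgHom.id K kp) (IsScalarTower.toAlgHom K Rp kp)
    have hq : Function.Surjective q :=
      TensorProduct.map_surjective Function.surjective_id hsurj
    have hqk : RingHom.ker q = pRp.map φ := by
      have := Algebra.TensorProduct.lTensor_ker (A := kp) (IsScalarTower.toAlgHom K Rp kp) hsurj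
      refine this.trans ?_
      have h2 : RingHom.ker (IsScalarTower.toAlgHom K Rp kp) = pRp := hker
      rw [h2]
    have hcomp : (Algebra.TensorProduct.lmul' K (S := kp)).comp q =
        Algebra.TensorProduct.productMap (AlgHom.id K kp)
        (IsScalarTower.toAlgHom K Rp kp) := by
      apply Algebra.TensorProduct.ext'
      intro a b
      simp [q]
    have hMq : MM = (KaehlerDifferential.ideal K kp).comap q := by
      ext z
      rw [hmem, ← hcomp]
      rfl
    have hmap : MM.map q = KaehlerDifferential.ideal K kp := by
      rw [hMq, Ideal.map_comap_of_surjective _ hq]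
    intro z hz
    have h1 : q z ∈ (MM ^ 2).map q := by
      rw [Ideal.map_pow, hmap, pow_two, hJ.eq, ← hmap]
      exact Ideal.mem_map_of_mem q hz
    obtain ⟨w, hw, hwz⟩ := (Ideal.mem_map_iff_of_surjective _ hq).1 h1
    have h2 : z - w ∈ pRp.map φ := by
      rw [← hqk, RingHom.mem_ker, map_sub, hwz, sub_self]
    have : z = (z - w) + w := by ring
    rw [this]
    exact Submodule.add_mem_sup h2 hw
  have hM1 : ∀ n : ℕ, MM ^ n ≤ (pRp ^ n).map φ ⊔ MM ^ (n + 1) := by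
    intro n
    induction n with
    | zero => simp [Ideal.map_top, Ideal.one_eq_top]
    | succ n ih =>
      calc MM ^ (n + 1) = MM ^ n * MM := pow_succ _ _
        _ ≤ ((pRp ^ n).map φ ⊔ MM ^ (n + 1)) * MM := Ideal.mul_mono_left ih
        _ = (pRp ^ n).map φ * MM ⊔ MM ^ (n + 1 + 1) := by
          rw [Ideal.sup_mul, ← pow_succ]
        _ ≤ _ := by
          refine sup_le ?_ le_sup_right
          refine (Ideal.mul_mono_right hM).trans ?_
          rw [Ideal.mul_sup]
          refine sup_le_sup ?_ ?_
          · rw [← Ideal.map_mul, ← pow_succ]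
          · have h3 : (pRp ^ n).map φ ≤ MM ^ n := by
              rw [Ideal.map_pow]; exact Ideal.pow_right_mono hmaple n
            refine (Ideal.mul_mono_left h3).trans ?_
            rw [← pow_add]
  have hT : ∀ z, ∃ r, z - φ r ∈ MM := by
    intro z
    obtain ⟨r, hr⟩ := hsurj (Algebra.TensorProduct.productMap (AlgHom.id K kp)
        (IsScalarTower.toAlgHom K Rp kp) z)
    refine ⟨r, ?_⟩
    rw [hmem, map_sub, ← hr, hφa]
    simp
  have hgr : ∀ n : ℕ, ∀ z ∈ MM ^ n, ∃ x ∈ pRp ^ n, z - φ x ∈ MM ^ (n + 1) := by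
    intro n z hz
    obtain ⟨a, ha, b, hb, rfl⟩ := Submodule.mem_sup.1 (hM1 n hz)
    have key : ∃ x ∈ pRp ^ n, a - φ x ∈ MM ^ (n + 1) := by
      clear hz
      refine Submodule.span_induction (p := fun a _ => ∃ x ∈ pRp ^ n, a - φ x ∈ MM ^ (n + 1))
        ?_ ?_ ?_ ?_ ha
      · rintro _ ⟨x, hx, rfl⟩
        exact ⟨x, hx, by simp⟩
      · exact ⟨0, zero_mem _, by simp⟩
      · rintro u v _ _ ⟨x, hx, hux⟩ ⟨y, hy, hvy⟩
        refine ⟨x + y, add_mem hx hy, ?_⟩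
        have : u + v - φ (x + y) = (u - φ x) + (v - φ y) := by rw [map_add]; ring
        rw [this]
        exact add_mem hux hvy
      · rintro c u _ ⟨x, hx, hux⟩
        obtain ⟨r, hr⟩ := hT c
        refine ⟨r * x, Ideal.mul_mem_left _ _ hx, ?_⟩
        have : c • u - φ (r * x) = c * (u - φ x) + φ x * (c - φ r) := by
          rw [map_mul, smul_eq_mul]; ring
        rw [this]
        refine add_mem (Ideal.mul_mem_left _ _ hux) ?_
        rw [pow_succ]
        exact Ideal.mul_mem_mul (hpow n x hx) hr
    obtain ⟨x, hx, h⟩ := key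
    refine ⟨x, hx, ?_⟩
    have : a + b - φ x = (a - φ x) + b := by ring
    rw [this]
    exact add_mem h hb
  have hsur : ∀ n : ℕ, ∀ z, ∃ x, z - φ x ∈ MM ^ n := by
    intro n z
    induction n with
    | zero => exact ⟨0, by simp⟩
    | succ n ih =>
      obtain ⟨x, hx⟩ := ih
      obtain ⟨y, _, hy⟩ := hgr n _ hx
      refine ⟨x + y, ?_⟩
      rw [map_add, ← sub_sub]
      exact hy
  exact ⟨fun n => ⟨hpow n, hgr n, fun x _ h => hinj (n + 1) x h⟩,
    fun n _ => ⟨hsur n, fun x => ⟨hinj n x, hpow n x⟩⟩⟩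

end NoetherianOps
end
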